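/- Let α,β,γ>-1, a∈(-1,1), and let m be the greatest integer strictly less than γ. Then there exist constants C>0 and N such that for every ψ ∈ W^{m+1}_AC((-1+a)/2,a) ∩ W^{m+2}_AC(-1,(-1+a)/2) and every integer n≥N, |∫_{-1}^a (a-x)^γ ψ(x) P_n^{(α,β)}(x) ω^{(α,β)}(x) dx| ≤ C (‖ψ‖_{W^{m+1}_AC((-1+a)/2,a)} + ‖ψ‖_{W^{m+2}_AC(-1,(-1+a)/2)}) · n^{-γ-3/2}. -/

import Mathlib

open MeasureTheory Set

/-- Jacobi polynomial via Rodrigues' formula. -/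
noncomputable def jacobiP (a b : ℝ) (n : ℕ) (x : ℝ) : ℝ :=
  ((-1 : ℝ) ^ n / (2 ^ n * (n.factorial : ℝ))) * (1 - x) ^ (-a) * (1 + x) ^ (-b) *
    iteratedDeriv n (fun y => (1 - y) ^ ((n : ℝ) + a) * (1 + y) ^ ((n : ℝ) + b)) x

/-- Jacobi weight. -/
noncomputable def jacobiWeight (a b : ℝ) (x : ℝ) : ℝ := (1 - x) ^ a * (1 + x) ^ b

/-- Normalization constant σ_n^{(α,β)}. -/
noncomputable def jacobiSigma (a b : ℝ) (n : ℕ) : ℝ :=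
  2 ^ (a + b + 1) * Real.Gamma ((n : ℝ) + a + 1) * Real.Gamma ((n : ℝ) + b + 1) /
    ((n.factorial : ℝ) * (2 * (n : ℝ) + a + b + 1) * Real.Gamma ((n : ℝ) + a + b + 1))

/-- Jacobi expansion coefficient of `f`. -/
noncomputable def jacobiCoeff (a b : ℝ) (n : ℕ) (f : ℝ → ℝ) : ℝ :=
  (1 / jacobiSigma a b n) * ∫ x in (-1 : ℝ)..1, f x * jacobiP a b n x * jacobiWeight a b x

/-- Truncated Jacobi expansion S_n^{(α,β)}[f]. -/
noncomputable def jacobiTrunc (a b : ℝ) (n : ℕ) (f : ℝ → ℝ) (x : ℝ) : ℝ :=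
  ∑ k ∈ Finset.range (n + 1), jacobiCoeff a b k f * jacobiP a b k x

/-- Pointwise error e_f^{(α,β)}(n,x). -/
noncomputable def jacobiErr (a b : ℝ) (n : ℕ) (f : ℝ → ℝ) (x : ℝ) : ℝ :=
  |f x - jacobiTrunc a b n f x|

/-- ψ is absolutely continuous on [a,b] with integrable derivative (FTC characterization). -/
def IsWAC (a b : ℝ) (psi : ℝ → ℝ) : Prop :=
  MeasureTheory.IntegrableOn (deriv psi) (Set.Ioo a b) ∧
  ∀ x ∈ Set.Icc a b, psi x = psi a + ∫ t in a..x, deriv psi t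

/-- The W_AC norm: ‖ψ‖_∞ + ‖ψ'‖_{L¹}. -/
noncomputable def wacNorm (a b : ℝ) (psi : ℝ → ℝ) : ℝ :=
  (⨆ x : Set.Icc a b, |psi (x : ℝ)|) + ∫ t in a..b, |deriv psi t|

/-- ψ ∈ W^m_AC(a,b): all derivatives up to order m lie in W_AC(a,b). -/
def IsWACIter (m : ℕ) (a b : ℝ) (psi : ℝ → ℝ) : Prop :=
  ∀ k ≤ m, IsWAC a b (iteratedDeriv k psi)

/-- The W^m_AC norm. -/
noncomputable def wacNormIter (m : ℕ) (a b : ℝ) (psi : ℝ → ℝ) : ℝ :=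
  ∑ k ∈ Finset.range (m + 1), wacNorm a b (iteratedDeriv k psi)



/-! ### Integration by parts for absolutely continuous functions -/

lemma jd_ibp {l r : ℝ} (hlr : l ≤ r) {u u' v v' : ℝ → ℝ}
    (hu' : IntervalIntegrable u' volume l r) (hv' : IntervalIntegrable v' volume l r)
    (hu : ∀ x ∈ Icc l r, u x = u l + ∫ t in l..x, u' t)
    (hv : ∀ x ∈ Icc l r, v x = v l + ∫ t in l..x, v' t) :
    ∫ x in l..r, u x * v' x = u r * v r - u l * v l - ∫ x in l..r, u' x * v x := by
  have key : ∀ {w w' : ℝ → ℝ}, IntervalIntegrable w' volume l r →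
      AbsolutelyContinuousOnInterval (fun x => w l + ∫ t in l..x, w' t) l r ∧
      ∀ᵐ x, x ∈ uIoc l r → deriv (fun x => w l + ∫ t in l..x, w' t) x = w' x := by
    intro w w' hw'
    have h1 := hw'.absolutelyContinuousOnInterval_intervalIntegral (c := l) (by simp)
    constructor
    · have h2 : AbsolutelyContinuousOnInterval (fun _ : ℝ => w l) l r := by
        have := ((LipschitzWith.const (α := ℝ) (w l)).lipschitzOnWith (s := uIcc l r)).absolutelyContinuousOnInterval
        simpa using this
      exact h2.add h1
    · filter_upwards [hw'.ae_hasDerivAt_integral] with x hx hxm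
      have := hx (uIoc_subset_uIcc hxm) l (by simp)
      exact (this.const_add (w l)).deriv
  obtain ⟨hU, hU'⟩ := key (w := u) hu'
  obtain ⟨hV, hV'⟩ := key (w := v) hv'
  have := hU.integral_mul_deriv_eq_deriv_mul hV
  have e1 : ∫ x in l..r, (u l + ∫ t in l..x, u' t) * deriv (fun x => v l + ∫ t in l..x, v' t) x
      = ∫ x in l..r, u x * v' x := by
    apply intervalIntegral.integral_congr_ae
    filter_upwards [hV'] with x hx hxm
    rw [hx hxm, hu x]
    have := uIoc_subset_uIcc hxm
    rwa [uIcc_of_le hlr] at this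
  have e2 : ∫ x in l..r, deriv (fun x => u l + ∫ t in l..x, u' t) x * (v l + ∫ t in l..x, v' t)
      = ∫ x in l..r, u' x * v x := by
    apply intervalIntegral.integral_congr_ae
    filter_upwards [hU'] with x hx hxm
    rw [hx hxm, hv x]
    have := uIoc_subset_uIcc hxm
    rwa [uIcc_of_le hlr] at this
  rw [e1, e2] at this
  rw [this, hu r (right_mem_Icc.2 hlr), hv r (right_mem_Icc.2 hlr)]
  simp

lemma jd_wac_ii {l r : ℝ} (hlr : l ≤ r) {ψ : ℝ → ℝ} (h : IsWAC l r ψ) :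
    IntervalIntegrable (deriv ψ) volume l r :=
  (intervalIntegrable_iff_integrableOn_Ioo_of_le hlr).2 h.1

lemma jd_wac_cont {l r : ℝ} (hlr : l ≤ r) {ψ : ℝ → ℝ} (h : IsWAC l r ψ) :
    ContinuousOn ψ (Icc l r) := by
  have h1 := intervalIntegral.continuousOn_primitive_interval' (jd_wac_ii hlr h) left_mem_uIcc
  rw [uIcc_of_le hlr] at h1
  exact (continuousOn_const.add h1).congr h.2

lemma jd_wac_concat {l c r : ℝ} (hlc : l ≤ c) (hcr : c ≤ r) {ψ : ℝ → ℝ} (h1 : IsWAC l c ψ)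
    (h2 : IsWAC c r ψ) : IsWAC l r ψ := by
  have i1 := jd_wac_ii hlc h1
  have i2 := jd_wac_ii hcr h2
  refine ⟨(intervalIntegrable_iff_integrableOn_Ioo_of_le (hlc.trans hcr)).1 (i1.trans i2), ?_⟩
  intro x hx
  rcases le_total x c with h | h
  · exact h1.2 x ⟨hx.1, h⟩
  · have e1 := h1.2 c ⟨hlc, le_rfl⟩
    have e2 := h2.2 x ⟨h, hx.2⟩
    have i3 : IntervalIntegrable (deriv ψ) volume c x :=
      i2.mono_set (by rw [uIcc_of_le h, uIcc_of_le hcr]; exact Icc_subset_Icc le_rfl hx.2)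
    rw [← intervalIntegral.integral_add_adjacent_intervals i1 i3]
    linarith

/-- Integration by parts for a `W_AC` function against a function with integrable derivative. -/
lemma jd_wac_ibp {l r : ℝ} (hlr : l ≤ r) {ψ v v' : ℝ → ℝ} (h : IsWAC l r ψ)
    (hv : ContinuousOn v (Icc l r)) (hd : ∀ x ∈ Ioo l r, HasDerivAt v (v' x) x)
    (hv' : IntervalIntegrable v' volume l r) :
    ∫ x in l..r, ψ x * v' x = ψ r * v r - ψ l * v l - ∫ x in l..r, deriv ψ x * v x := by
  refine jd_ibp hlr (jd_wac_ii hlr h) hv' h.2 ?_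
  intro x hx
  rw [intervalIntegral.integral_eq_sub_of_hasDerivAt_of_le hx.1
    (hv.mono (Icc_subset_Icc le_rfl hx.2)) (fun y hy => hd y ⟨hy.1, hy.2.trans_le hx.2⟩)
    (hv'.mono_set (by rw [uIcc_of_le hx.1, uIcc_of_le hlr]; exact Icc_subset_Icc le_rfl hx.2))]
  ring

lemma jd_wac_bdd {l r : ℝ} (hlr : l ≤ r) {ψ : ℝ → ℝ} (h : IsWAC l r ψ) {x : ℝ}
    (hx : x ∈ Icc l r) : |ψ x| ≤ wacNorm l r ψ := by
  have hb : BddAbove (Set.range fun y : Icc l r => |ψ (y : ℝ)|) := by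
    have := (isCompact_Icc.image_of_continuousOn (jd_wac_cont hlr h).abs).bddAbove
    rw [Set.image_eq_range] at this
    exact this
  have h1 := le_ciSup hb ⟨x, hx⟩
  have h2 : 0 ≤ ∫ t in l..r, |deriv ψ t| :=
    intervalIntegral.integral_nonneg hlr (fun _ _ => abs_nonneg _)
  unfold wacNorm
  simp only at h1
  linarith

lemma jd_wacNorm_nonneg {l r : ℝ} (hlr : l ≤ r) (ψ : ℝ → ℝ) : 0 ≤ wacNorm l r ψ := by
  have h2 : 0 ≤ ∫ t in l..r, |deriv ψ t| :=
    intervalIntegral.integral_nonneg hlr (fun _ _ => abs_nonneg _)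
  have h1 : 0 ≤ (⨆ x : Icc l r, |ψ (x : ℝ)|) := Real.iSup_nonneg (fun _ => abs_nonneg _)
  unfold wacNorm
  linarith

lemma jd_wac_l1 {l r : ℝ} (ψ : ℝ → ℝ) :
    ∫ t in l..r, |deriv ψ t| ≤ wacNorm l r ψ := by
  have h1 : 0 ≤ (⨆ x : Icc l r, |ψ (x : ℝ)|) := Real.iSup_nonneg (fun _ => abs_nonneg _)
  unfold wacNorm
  linarith

/-- Bound of `∫ ψ' v` by sup of `v`. -/
lemma jd_wac_deriv_bound {l r : ℝ} (hlr : l ≤ r) {ψ v : ℝ → ℝ} (h : IsWAC l r ψ) {K : ℝ}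
    (hK : ∀ x ∈ Icc l r, |v x| ≤ K) :
    |∫ x in l..r, deriv ψ x * v x| ≤ K * wacNorm l r ψ := by
  have hK0 : 0 ≤ K := (abs_nonneg _).trans (hK l (left_mem_Icc.2 hlr))
  calc |∫ x in l..r, deriv ψ x * v x| ≤ ∫ x in l..r, K * |deriv ψ x| := by
        rw [← Real.norm_eq_abs]
        apply intervalIntegral.norm_integral_le_of_norm_le hlr
        · refine Filter.Eventually.of_forall ?_
          intro x hx
          rw [Real.norm_eq_abs, abs_mul, mul_comm]
          exact mul_le_mul_of_nonneg_right (hK x (Ioc_subset_Icc_self hx)) (abs_nonneg _)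
        · exact ((jd_wac_ii hlr h).abs).const_mul K
    _ = K * ∫ x in l..r, |deriv ψ x| := by simp
    _ ≤ _ := mul_le_mul_of_nonneg_left (jd_wac_l1 ψ) hK0

lemma jd_iter_zero {M : ℕ} {l r : ℝ} {ψ : ℝ → ℝ} (h : IsWACIter M l r ψ) : IsWAC l r ψ := by
  simpa using h 0 (Nat.zero_le _)

lemma jd_iter_mono {M M' : ℕ} (hM : M ≤ M') {l r : ℝ} {ψ : ℝ → ℝ} (h : IsWACIter M' l r ψ) :
    IsWACIter M l r ψ := fun k hk => h k (hk.trans hM)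

lemma jd_iter_deriv {M : ℕ} {l r : ℝ} {ψ : ℝ → ℝ} (h : IsWACIter (M + 1) l r ψ) :
    IsWACIter M l r (deriv ψ) := by
  intro k hk
  rw [← iteratedDeriv_succ']
  exact h (k + 1) (by omega)

lemma jd_normIter_nonneg (M : ℕ) {l r : ℝ} (hlr : l ≤ r) (ψ : ℝ → ℝ) :
    0 ≤ wacNormIter M l r ψ := Finset.sum_nonneg (fun _ _ => jd_wacNorm_nonneg hlr _)

lemma jd_normIter_zero (M : ℕ) {l r : ℝ} (hlr : l ≤ r) (ψ : ℝ → ℝ) :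
    wacNorm l r ψ ≤ wacNormIter M l r ψ := by
  have := Finset.single_le_sum (f := fun k => wacNorm l r (iteratedDeriv k ψ))
    (fun _ _ => jd_wacNorm_nonneg hlr _) (Finset.mem_range.2 (Nat.succ_pos M))
  simpa [wacNormIter] using this

lemma jd_normIter_succ (M : ℕ) {l r : ℝ} (hlr : l ≤ r) (ψ : ℝ → ℝ) :
    wacNormIter M l r ψ ≤ wacNormIter (M + 1) l r ψ := by
  unfold wacNormIter
  rw [Finset.sum_range_succ _ (M + 1)]
  linarith [jd_wacNorm_nonneg hlr (iteratedDeriv (M + 1) ψ)]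

lemma jd_normIter_deriv (M : ℕ) {l r : ℝ} (hlr : l ≤ r) (ψ : ℝ → ℝ) :
    wacNormIter M l r (deriv ψ) ≤ wacNormIter (M + 1) l r ψ := by
  unfold wacNormIter
  rw [Finset.sum_range_succ' _ (M + 1)]
  simp only [iteratedDeriv_succ']
  linarith [jd_wacNorm_nonneg hlr (iteratedDeriv 0 ψ)]

/-! ### Jacobi polynomials and their structure -/

open Polynomial in
/-- `L_{α,β} q`, defined so that `(q ω^{(α+1,β+1)})' = (L q) ω^{(α,β)}`. -/
noncomputable def jL (α β : ℝ) (q : ℝ[X]) : ℝ[X] :=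
  (1 - X ^ 2) * derivative q + (C (β - α) - C (α + β + 2) * X) * q

open Polynomial in
/-- Jacobi polynomials through the Rodrigues recursion. -/
noncomputable def jp : ℕ → ℝ → ℝ → ℝ[X]
  | 0, _, _ => 1
  | n + 1, α, β => C (-1 / (2 * ((n : ℝ) + 1))) * jL α β (jp n (α + 1) (β + 1))

lemma jL_eval (α β : ℝ) (q : Polynomial ℝ) (x : ℝ) : (jL α β q).eval x =
    (1 - x ^ 2) * (Polynomial.derivative q).eval x + ((β - α) - (α + β + 2) * x) * q.eval x := by
  simp [jL]

lemma jL_mul (α β : ℝ) (p q : Polynomial ℝ) :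
    jL α β (p * q) = p * jL α β q + (1 - Polynomial.X ^ 2) * Polynomial.derivative p * q := by
  simp only [jL, Polynomial.derivative_mul]; ring

lemma jL_C_mul (α β c : ℝ) (q : Polynomial ℝ) :
    jL α β (Polynomial.C c * q) = Polynomial.C c * jL α β q := by
  rw [jL_mul]; simp

lemma jL_jp (n : ℕ) (α β : ℝ) :
    jL α β (jp n (α + 1) (β + 1)) = Polynomial.C (-2 * ((n : ℝ) + 1)) * jp (n + 1) α β := by
  have : ((n : ℝ) + 1) ≠ 0 := by positivity
  rw [jp, ← mul_assoc, ← Polynomial.C_mul]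
  have e : -2 * ((n : ℝ) + 1) * (-1 / (2 * ((n : ℝ) + 1))) = 1 := by field_simp
  rw [e]; simp

lemma jL_deriv (α β : ℝ) (q : Polynomial ℝ) :
    Polynomial.derivative (jL α β q) =
      jL (α + 1) (β + 1) (Polynomial.derivative q) - Polynomial.C (α + β + 2) * q := by
  apply Polynomial.funext
  intro x
  simp [jL]
  ring

/-- derivative formula -/
lemma jp_deriv (n : ℕ) : ∀ α β : ℝ, Polynomial.derivative (jp (n + 1) α β) =
    Polynomial.C (((n : ℝ) + α + β + 2) / 2) * jp n (α + 1) (β + 1) := by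
  induction n with
  | zero =>
    intro α β
    apply Polynomial.funext
    intro x
    simp [jp, jL]
    ring
  | succ n ih =>
    intro α β
    rw [jp, Polynomial.derivative_C_mul, jL_deriv, ih, jL_C_mul, jL_jp]
    apply Polynomial.funext
    intro x
    simp only [Polynomial.eval_mul, Polynomial.eval_sub, Polynomial.eval_C]
    push_cast
    have : ((n : ℝ) + 2) ≠ 0 := by positivity
    have : ((n : ℝ) + 1 + 1) ≠ 0 := by positivity
    field_simp
    ring

/-- The differential equation. -/
lemma jp_ode (n : ℕ) (α β x : ℝ) :
    (1 - x ^ 2) * (Polynomial.derivative (Polynomial.derivative (jp n α β))).eval x +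
      ((β - α) - (α + β + 2) * x) * (Polynomial.derivative (jp n α β)).eval x =
      - ((n : ℝ) * (n + α + β + 1)) * (jp n α β).eval x := by
  rw [← jL_eval]
  cases n with
  | zero => simp [jp, jL]
  | succ n =>
    rw [jp_deriv, jL_C_mul, jL_jp]
    simp
    ring

lemma jw_pos {α β x : ℝ} (hx : x ∈ Ioo (-1 : ℝ) 1) : 0 < jacobiWeight α β x :=
  mul_pos (Real.rpow_pos_of_pos (by linarith [hx.2]) _) (Real.rpow_pos_of_pos (by linarith [hx.1]) _)

lemma jw_nonneg {α β x : ℝ} (hx : x ∈ Icc (-1 : ℝ) 1) : 0 ≤ jacobiWeight α β x :=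
  mul_nonneg (Real.rpow_nonneg (by linarith [hx.2]) _) (Real.rpow_nonneg (by linarith [hx.1]) _)

lemma jw_succ {α β x : ℝ} (hx : x ∈ Ioo (-1 : ℝ) 1) :
    jacobiWeight (α + 1) (β + 1) x = (1 - x ^ 2) * jacobiWeight α β x := by
  unfold jacobiWeight
  rw [Real.rpow_add_one (by linarith [hx.2]), Real.rpow_add_one (by linarith [hx.1])]
  ring

lemma jw_hasDerivAt {α β x : ℝ} (hx : x ∈ Ioo (-1 : ℝ) 1) :
    HasDerivAt (jacobiWeight (α + 1) (β + 1))
      (((β - α) - (α + β + 2) * x) * jacobiWeight α β x) x := by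
  have h1 : HasDerivAt (fun y : ℝ => (1 - y) ^ (α + 1)) (-(α + 1) * (1 - x) ^ α) x := by
    have := ((hasDerivAt_id x).const_sub 1).rpow_const (p := α + 1)
      (Or.inl (by simp only [id]; linarith [hx.2]))
    exact this.congr_deriv (by simp)
  have h2 : HasDerivAt (fun y : ℝ => (1 + y) ^ (β + 1)) ((β + 1) * (1 + x) ^ β) x := by
    have := ((hasDerivAt_id x).const_add 1).rpow_const (p := β + 1)
      (Or.inl (by simp only [id]; linarith [hx.1]))
    exact this.congr_deriv (by simp)
  have := h1.mul h2
  refine this.congr_deriv ?_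
  unfold jacobiWeight
  rw [Real.rpow_add_one (x := 1 - x) (by linarith [hx.2]),
    Real.rpow_add_one (x := 1 + x) (by linarith [hx.1])]
  ring

lemma jL_hasDerivAt {α β x : ℝ} (hx : x ∈ Ioo (-1 : ℝ) 1) (q : Polynomial ℝ) :
    HasDerivAt (fun y => q.eval y * jacobiWeight (α + 1) (β + 1) y)
      ((jL α β q).eval x * jacobiWeight α β x) x := by
  have := (q.hasDerivAt x).mul (jw_hasDerivAt (α := α) (β := β) hx)
  refine this.congr_deriv ?_
  rw [jL_eval, jw_succ hx]
  ring

/-- The weighted Jacobi polynomial `P_n ω`. -/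
noncomputable def jJ (n : ℕ) (α β x : ℝ) : ℝ := (jp n α β).eval x * jacobiWeight α β x

lemma jJ_hasDerivAt (n : ℕ) {α β x : ℝ} (hx : x ∈ Ioo (-1 : ℝ) 1) :
    HasDerivAt (jJ n (α + 1) (β + 1)) (-2 * ((n : ℝ) + 1) * jJ (n + 1) α β x) x := by
  have := jL_hasDerivAt (α := α) (β := β) hx (jp n (α + 1) (β + 1))
  refine this.congr_deriv ?_
  rw [jL_jp, Polynomial.eval_mul, Polynomial.eval_C, jJ]
  ring

lemma jJ_rodrigues (n : ℕ) : ∀ α β x : ℝ, x ∈ Ioo (-1 : ℝ) 1 →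
    iteratedDeriv n (fun y : ℝ => (1 - y) ^ ((n : ℝ) + α) * (1 + y) ^ ((n : ℝ) + β)) x =
      (-1) ^ n * (2 ^ n * (n.factorial : ℝ)) * jJ n α β x := by
  induction n with
  | zero => intro α β x hx; simp [jJ, jp, jacobiWeight]
  | succ n ih =>
    intro α β x hx
    rw [iteratedDeriv_succ]
    have ev : iteratedDeriv n (fun y : ℝ => (1 - y) ^ (((n + 1 : ℕ) : ℝ) + α) *
        (1 + y) ^ (((n + 1 : ℕ) : ℝ) + β)) =ᶠ[nhds x]
        fun y => (-1) ^ n * (2 ^ n * (n.factorial : ℝ)) * jJ n (α + 1) (β + 1) y := by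
      filter_upwards [isOpen_Ioo.mem_nhds hx] with y hy
      rw [← ih (α + 1) (β + 1) y hy]
      congr 1
      funext z
      push_cast
      congr 2 <;> ring
    rw [ev.deriv_eq, ((jJ_hasDerivAt n hx).const_mul _).deriv, Nat.factorial_succ]
    push_cast
    ring

lemma jacobi_eq_jJ (n : ℕ) {α β x : ℝ} (hx : x ∈ Ioo (-1 : ℝ) 1) :
    jacobiP α β n x * jacobiWeight α β x = jJ n α β x := by
  unfold jacobiP jacobiWeight
  rw [jJ_rodrigues n α β x hx]
  have h1 : (1 - x) ^ (-α) * (1 - x) ^ α = 1 := by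
    rw [← Real.rpow_add (by linarith [hx.2])]; simp
  have h2 : (1 + x) ^ (-β) * (1 + x) ^ β = 1 := by
    rw [← Real.rpow_add (by linarith [hx.1])]; simp
  have h3 : ((-1 : ℝ)) ^ n * (-1) ^ n = 1 := by rw [← mul_pow]; simp
  have h4 : (2 : ℝ) ^ n * (n.factorial : ℝ) ≠ 0 := by positivity
  calc _ = ((-1 : ℝ) ^ n * (-1) ^ n) * ((2 ^ n * (n.factorial : ℝ)) / (2 ^ n * (n.factorial : ℝ)))
        * ((1 - x) ^ (-α) * (1 - x) ^ α) * ((1 + x) ^ (-β) * (1 + x) ^ β) * jJ n α β x := by ring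
    _ = _ := by rw [h1, h2, h3, div_self h4]; ring

lemma jw_continuous {α β : ℝ} (hα : 0 ≤ α) (hβ : 0 ≤ β) : Continuous (jacobiWeight α β) := by
  unfold jacobiWeight
  exact ((continuous_const.sub continuous_id).rpow_const (fun _ => Or.inr hα)).mul
    ((continuous_const.add continuous_id).rpow_const (fun _ => Or.inr hβ))

lemma jJ_continuous (n : ℕ) {α β : ℝ} (hα : 0 ≤ α) (hβ : 0 ≤ β) : Continuous (jJ n α β) :=
  (jp n α β).continuous.mul (jw_continuous hα hβ)

/-- integrability of products of two one-sided singularities -/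
lemma jd_sing_integrable {l r s t : ℝ} (hlr : l < r) (hs : -1 < s) (ht : -1 < t) {f : ℝ → ℝ}
    (hf : ContinuousOn f (Icc l r)) :
    IntervalIntegrable (fun x => (r - x) ^ s * (x - l) ^ t * f x) volume l r := by
  set c := (l + r) / 2 with hc
  have h1 : l < c := by linarith
  have h2 : c < r := by linarith
  have i1 : IntervalIntegrable (fun x => (x - l) ^ t) volume l c := by
    have := (intervalIntegral.intervalIntegrable_rpow' ht (a := 0) (b := c - l)).comp_sub_right l
    simpa using this
  have i2 : IntervalIntegrable (fun x => (r - x) ^ s) volume c r := by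
    have := (intervalIntegral.intervalIntegrable_rpow' hs (a := r - c) (b := 0)).comp_sub_left r
    simpa using this
  have c1 : ContinuousOn (fun x => (r - x) ^ s * f x) (uIcc l c) := by
    rw [uIcc_of_le h1.le]
    refine ContinuousOn.mul ?_ (hf.mono (Icc_subset_Icc le_rfl h2.le))
    exact (continuousOn_const.sub continuousOn_id).rpow_const
      (fun x hx => Or.inl (by simp; linarith [hx.2]))
  have c2 : ContinuousOn (fun x => (x - l) ^ t * f x) (uIcc c r) := by
    rw [uIcc_of_le h2.le]
    refine ContinuousOn.mul ?_ (hf.mono (Icc_subset_Icc h1.le le_rfl))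
    exact (continuousOn_id.sub continuousOn_const).rpow_const
      (fun x hx => Or.inl (by simp; linarith [hx.1]))
  refine IntervalIntegrable.trans (b := c) ?_ ?_
  · refine (i1.mul_continuousOn c1).congr ?_
    exact fun x _ => by ring
  · refine (i2.mul_continuousOn c2).congr ?_
    exact fun x _ => by ring

lemma jw_integrable {α β : ℝ} (hα : -1 < α) (hβ : -1 < β) {f : ℝ → ℝ}
    (hf : ContinuousOn f (Icc (-1) 1)) :
    IntervalIntegrable (fun x => f x * jacobiWeight α β x) volume (-1) 1 := by
  refine (jd_sing_integrable (by norm_num) hα hβ hf).congr ?_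
  intro x _
  simp only [jacobiWeight, sub_neg_eq_add]
  rw [add_comm x 1]; ring

lemma jL_integral {α β : ℝ} (hα : -1 < α) (hβ : -1 < β) (q : Polynomial ℝ) :
    ∫ x in (-1 : ℝ)..1, (jL α β q).eval x * jacobiWeight α β x = 0 := by
  rw [intervalIntegral.integral_eq_sub_of_hasDerivAt_of_le (by norm_num)
    (f := fun y => q.eval y * jacobiWeight (α + 1) (β + 1) y)
    ((q.continuous.mul (jw_continuous (by linarith) (by linarith))).continuousOn)
    (fun x hx => jL_hasDerivAt hx q) (jw_integrable hα hβ (Polynomial.continuous _).continuousOn)]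
  have h1 : α + 1 ≠ 0 := by linarith
  have h2 : β + 1 ≠ 0 := by linarith
  simp [jacobiWeight, Real.zero_rpow h1, Real.zero_rpow h2]

/-! ### The `L²` norms -/

/-- weighted integral of a polynomial -/
noncomputable def jI (α β : ℝ) (q : Polynomial ℝ) : ℝ :=
  ∫ x in (-1 : ℝ)..1, q.eval x * jacobiWeight α β x

lemma jI_ii {α β : ℝ} (hα : -1 < α) (hβ : -1 < β) (q : Polynomial ℝ) :
    IntervalIntegrable (fun x => q.eval x * jacobiWeight α β x) volume (-1) 1 :=
  jw_integrable hα hβ q.continuous.continuousOn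

lemma jI_add {α β : ℝ} (hα : -1 < α) (hβ : -1 < β) (p q : Polynomial ℝ) :
    jI α β (p + q) = jI α β p + jI α β q := by
  unfold jI
  rw [← intervalIntegral.integral_add (jI_ii hα hβ p) (jI_ii hα hβ q)]
  congr 1; funext x; simp; ring

lemma jI_C_mul {α β : ℝ} (c : ℝ) (p : Polynomial ℝ) :
    jI α β (Polynomial.C c * p) = c * jI α β p := by
  unfold jI
  rw [← intervalIntegral.integral_const_mul]
  congr 1; funext x; simp; ring

lemma jd_integral_congr_Ioo {l r : ℝ} (hlr : l ≤ r) {f g : ℝ → ℝ} (h : ∀ x ∈ Ioo l r, f x = g x) :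
    ∫ x in l..r, f x = ∫ x in l..r, g x := by
  rw [intervalIntegral.integral_of_le hlr, intervalIntegral.integral_of_le hlr,
    integral_Ioc_eq_integral_Ioo, integral_Ioc_eq_integral_Ioo]
  exact setIntegral_congr_fun measurableSet_Ioo h

lemma jI_succ {α β : ℝ} (p : Polynomial ℝ) :
    jI (α + 1) (β + 1) p = jI α β ((1 - Polynomial.X ^ 2) * p) := by
  unfold jI
  apply jd_integral_congr_Ioo (by norm_num)
  intro x hx
  rw [jw_succ hx]; simp; ring

lemma jI_jL {α β : ℝ} (hα : -1 < α) (hβ : -1 < β) (q : Polynomial ℝ) : jI α β (jL α β q) = 0 :=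
  jL_integral hα hβ q

lemma jI_sq_nonneg (α β : ℝ) (q : Polynomial ℝ) : 0 ≤ jI α β (q ^ 2) := by
  unfold jI
  apply intervalIntegral.integral_nonneg (by norm_num)
  intro x hx
  have := jw_nonneg (α := α) (β := β) hx
  simp; positivity

/-- squared norm -/
noncomputable def jh (n : ℕ) (α β : ℝ) : ℝ := jI α β (jp n α β ^ 2)

lemma jh_nonneg (n : ℕ) (α β : ℝ) : 0 ≤ jh n α β := jI_sq_nonneg _ _ _

lemma jh_beta {α β : ℝ} (hα : -1 < α) (hβ : -1 < β) :
    (α + β + 2) * (α + β + 3) * jh 0 (α + 1) (β + 1) = 4 * (α + 1) * (β + 1) * jh 0 α β := by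
  have h1 := jI_jL hα hβ 1
  have h2 := jI_jL hα hβ Polynomial.X
  have e1 : jL α β 1 = Polynomial.C (β - α) * 1 + Polynomial.C (-(α + β + 2)) * Polynomial.X := by
    apply Polynomial.funext; intro x; simp [jL]; ring
  have e2 : jL α β Polynomial.X = Polynomial.C (α + β + 3) * ((1 - Polynomial.X ^ 2) * 1 ^ 2) +
      (Polynomial.C (β - α) * Polynomial.X + Polynomial.C (-(α + β + 2)) * 1) := by
    apply Polynomial.funext; intro x; simp [jL]; ring
  rw [e1, jI_add hα hβ, jI_C_mul, jI_C_mul] at h1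
  rw [e2, jI_add hα hβ, jI_add hα hβ, jI_C_mul, jI_C_mul, jI_C_mul, ← jI_succ] at h2
  simp only [jh, jp]
  simp only [one_pow] at *
  linear_combination (α + β + 2) * h2 + (β - α) * h1

lemma jh_succ (n : ℕ) {α β : ℝ} (hα : -1 < α) (hβ : -1 < β) :
    4 * ((n : ℝ) + 1) * jh (n + 1) α β = ((n : ℝ) + α + β + 2) * jh n (α + 1) (β + 1) := by
  have h1 := jI_jL hα hβ (jp (n + 1) α β * jp n (α + 1) (β + 1))
  have e1 : jL α β (jp (n + 1) α β * jp n (α + 1) (β + 1)) =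
      Polynomial.C (-2 * ((n : ℝ) + 1)) * jp (n + 1) α β ^ 2 +
      Polynomial.C (((n : ℝ) + α + β + 2) / 2) *
        ((1 - Polynomial.X ^ 2) * jp n (α + 1) (β + 1) ^ 2) := by
    rw [jL_mul, jL_jp, jp_deriv]; ring
  rw [e1, jI_add hα hβ, jI_C_mul, jI_C_mul, ← jI_succ] at h1
  unfold jh
  linarith

lemma jI_deriv_sq (n : ℕ) {α β : ℝ} (hα : -1 < α) (hβ : -1 < β) :
    jI (α + 1) (β + 1) (Polynomial.derivative (jp n α β) ^ 2) =
      (n : ℝ) * (n + α + β + 1) * jh n α β := by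
  cases n with
  | zero => simp [jp, jI]
  | succ n =>
    have h := jh_succ n hα hβ
    rw [jp_deriv, mul_pow, ← Polynomial.C_pow, jI_C_mul]
    have : jI (α + 1) (β + 1) (jp n (α + 1) (β + 1) ^ 2) = jh n (α + 1) (β + 1) := rfl
    rw [this]
    push_cast
    linear_combination (-((n : ℝ) + α + β + 2) / 4) * h

lemma jh_ratio (n : ℕ) : ∀ {α β : ℝ}, -1 < α → -1 < β →
    (2 * (n : ℝ) + α + β + 3) * (n + α + β + 1) * (n + 1) * jh (n + 1) α β =
      (α + n + 1) * (β + n + 1) * (2 * n + α + β + 1) * jh n α β := by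
  induction n with
  | zero =>
    intro α β hα hβ
    have h1 := jh_succ 0 hα hβ
    have h2 := jh_beta hα hβ
    push_cast at *
    have e : (α + β + 3) * jh (0 + 1) α β = (α + 1) * (β + 1) * jh 0 α β := by
      linear_combination (1 / 4) * (α + β + 3) * h1 + (1 / 4) * h2
    linear_combination (α + β + 1) * e
  | succ n ih =>
    intro α β hα hβ
    have h1 := jh_succ (n + 1) hα hβ
    have h2 := jh_succ n hα hβ
    have h3 := ih (α := α + 1) (β := β + 1) (by linarith) (by linarith)
    push_cast at *
    have p1 : (n : ℝ) + α + β + 3 ≠ 0 := by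
      have : (0 : ℝ) ≤ n := n.cast_nonneg
      linarith
    have p2 : (n : ℝ) + 1 ≠ 0 := by positivity
    apply mul_left_cancel₀ (mul_ne_zero p1 p2)
    linear_combination (1 / 4) * (2 * (n : ℝ) + α + β + 5) * (n + α + β + 2) * (n + α + β + 3) * (n + 1) * h1
      + (1 / 4) * (n + α + β + 2) * (n + α + β + 3) * h3
      - (1 / 4) * (α + n + 2) * (β + n + 2) * (2 * n + α + β + 3) * (n + α + β + 3) * h2

lemma jd_aux_ratio {P x y c : ℝ} (hP : P ≠ 0) (h : P * x = (P + c) * y) :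
    x = y * (1 + c / P) := by
  field_simp
  linear_combination h

lemma jh_bound {α β : ℝ} (hα : -1 < α) (hβ : -1 < β) :
    ∃ C : ℝ, 0 < C ∧ ∀ n : ℕ, jh n α β ≤ C / ((n : ℝ) + 1) := by
  set H : ℕ → ℝ := fun k => (2 * ((k + 3 : ℕ) : ℝ) + α + β + 1) * jh (k + 3) α β with hH
  set D := |α * β| with hD
  have hH0 : ∀ k, 0 ≤ H k := by
    intro k
    have : (0 : ℝ) ≤ k := k.cast_nonneg
    refine mul_nonneg ?_ (jh_nonneg _ _ _)
    push_cast; linarith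
  have hstep : ∀ k, H (k + 1) ≤ H k * (1 + D / (((k : ℝ) + 1) * (k + 2))) := by
    intro k
    have hk : (0 : ℝ) ≤ k := k.cast_nonneg
    have h := jh_ratio (k + 3) hα hβ
    have p : 0 < ((k : ℝ) + 4 + α + β) * (k + 4) := by
      apply mul_pos <;> linarith
    have h' : ((k : ℝ) + 4 + α + β) * (k + 4) * H (k + 1) =
        (((k : ℝ) + 4 + α + β) * (k + 4) + α * β) * H k := by
      simp only [hH]
      push_cast at *
      linear_combination h
    have hle : ((k : ℝ) + 1) * (k + 2) ≤ ((k : ℝ) + 4 + α + β) * (k + 4) := by nlinarith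
    have e : H (k + 1) = H k * (1 + α * β / (((k : ℝ) + 4 + α + β) * (k + 4))) := by
      exact jd_aux_ratio p.ne' h'
    rw [e]
    apply mul_le_mul_of_nonneg_left _ (hH0 k)
    have : α * β / (((k : ℝ) + 4 + α + β) * (k + 4)) ≤ D / (((k : ℝ) + 1) * (k + 2)) :=
      div_le_div₀ (abs_nonneg _) (le_abs_self _) (by positivity) hle
    linarith
  have hanti : Antitone (fun k : ℕ => H k * Real.exp (D / ((k : ℝ) + 1))) := by
    apply antitone_nat_of_succ_le
    intro k
    have hk : (0 : ℝ) ≤ k := k.cast_nonneg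
    have e : D / ((k : ℝ) + 1) = D / (((k : ℝ) + 1) * (k + 2)) + D / ((k : ℝ) + 1 + 1) := by
      field_simp; ring
    rw [e, Real.exp_add, ← mul_assoc]
    push_cast
    apply mul_le_mul_of_nonneg_right _ (Real.exp_pos _).le
    refine (hstep k).trans (mul_le_mul_of_nonneg_left ?_ (hH0 k))
    linarith [Real.add_one_le_exp (D / (((k : ℝ) + 1) * (k + 2)))]
  set K := H 0 * Real.exp D with hK
  have hHK : ∀ k, H k ≤ K := by
    intro k
    have h1 := hanti (Nat.zero_le k)
    simp at h1
    have h2 : 1 ≤ Real.exp (D / ((k : ℝ) + 1)) := Real.one_le_exp (by positivity)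
    have := le_mul_of_one_le_right (hH0 k) h2
    linarith
  have hK0 : 0 ≤ K := mul_nonneg (hH0 0) (Real.exp_pos _).le
  refine ⟨K + jh 0 α β + 2 * jh 1 α β + 3 * jh 2 α β + 1, ?_, ?_⟩
  · linarith [jh_nonneg 0 α β, jh_nonneg 1 α β, jh_nonneg 2 α β]
  intro n
  rw [le_div_iff₀ (by positivity)]
  have g0 := jh_nonneg 0 α β
  have g1 := jh_nonneg 1 α β
  have g2 := jh_nonneg 2 α β
  match n with
  | 0 => push_cast; linarith
  | 1 => push_cast; linarith
  | 2 => push_cast; linarith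
  | k + 3 =>
    have hk : (0 : ℝ) ≤ k := k.cast_nonneg
    have h1 := hHK k
    have h2 : jh (k + 3) α β * (((k + 3 : ℕ) : ℝ) + 1) ≤ H k := by
      simp only [hH]
      rw [mul_comm]
      apply mul_le_mul_of_nonneg_right _ (jh_nonneg _ _ _)
      push_cast; linarith
    linarith

/-! ### Pointwise bounds -/

lemma jd_gronwall {l r A : ℝ} (hA : 0 ≤ A) {f f' : ℝ → ℝ} (hf : ∀ x, HasDerivAt f (f' x) x)
    (hb : ∀ x ∈ Icc l r, |f' x| ≤ A * f x) (h0 : ∀ x ∈ Icc l r, 0 ≤ f x) {x z : ℝ}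
    (hx : x ∈ Icc l r) (hz : z ∈ Icc l r) : f x ≤ Real.exp (A * (r - l)) * f z := by
  have hd : ∀ s y : ℝ, HasDerivAt (fun y => f y * Real.exp (s * y))
      ((f' y + s * f y) * Real.exp (s * y)) y := by
    intro s y
    have h1 : HasDerivAt (fun y => Real.exp (s * y)) (Real.exp (s * y) * s) y := by
      have := ((hasDerivAt_id y).const_mul s).exp
      simpa using this
    exact ((hf y).mul h1).congr_deriv (by ring)
  rcases le_total x z with h | h
  · have hm : MonotoneOn (fun y => f y * Real.exp (A * y)) (Icc l r) := by
      apply monotoneOn_of_deriv_nonneg (convex_Icc l r)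
      · exact fun y _ => (hd A y).continuousAt.continuousWithinAt
      · exact fun y _ => (hd A y).differentiableAt.differentiableWithinAt
      · intro y hy
        rw [(hd A y).deriv]
        have := hb y (interior_subset hy)
        have := neg_abs_le (f' y)
        exact mul_nonneg (by linarith) (Real.exp_pos _).le
    have h1 : f x * Real.exp (A * x) ≤ f z * Real.exp (A * z) := hm hx hz h
    have h2 : f x = (f x * Real.exp (A * x)) * Real.exp (-(A * x)) := by
      rw [mul_assoc, ← Real.exp_add]; simp
    rw [h2]
    calc _ ≤ (f z * Real.exp (A * z)) * Real.exp (-(A * x)) :=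
          mul_le_mul_of_nonneg_right h1 (Real.exp_pos _).le
      _ = Real.exp (A * (z - x)) * f z := by
          rw [mul_assoc, ← Real.exp_add, mul_comm]; congr 2; ring
      _ ≤ _ := by
          apply mul_le_mul_of_nonneg_right _ (h0 z hz)
          apply Real.exp_le_exp.2
          apply mul_le_mul_of_nonneg_left _ hA
          linarith [hz.2, hx.1]
  · have hm : AntitoneOn (fun y => f y * Real.exp (-A * y)) (Icc l r) := by
      apply antitoneOn_of_deriv_nonpos (convex_Icc l r)
      · exact fun y _ => (hd (-A) y).continuousAt.continuousWithinAt
      · exact fun y _ => (hd (-A) y).differentiableAt.differentiableWithinAt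
      · intro y hy
        rw [(hd (-A) y).deriv]
        have := hb y (interior_subset hy)
        have := le_abs_self (f' y)
        exact mul_nonpos_of_nonpos_of_nonneg (by linarith) (Real.exp_pos _).le
    have h1 : f x * Real.exp (-A * x) ≤ f z * Real.exp (-A * z) := hm hz hx h
    have h2 : f x = (f x * Real.exp (-A * x)) * Real.exp (A * x) := by
      rw [mul_assoc, ← Real.exp_add]; simp
    rw [h2]
    calc _ ≤ (f z * Real.exp (-A * z)) * Real.exp (A * x) :=
          mul_le_mul_of_nonneg_right h1 (Real.exp_pos _).le
      _ = Real.exp (A * (x - z)) * f z := by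
          rw [mul_assoc, ← Real.exp_add, mul_comm]; congr 2; ring
      _ ≤ _ := by
          apply mul_le_mul_of_nonneg_right _ (h0 z hz)
          apply Real.exp_le_exp.2
          apply mul_le_mul_of_nonneg_left _ hA
          linarith [hx.2, hz.1]

lemma jw_continuousOn {α β l r : ℝ} (hl : -1 < l) (hr : r < 1) :
    ContinuousOn (jacobiWeight α β) (Icc l r) := by
  unfold jacobiWeight
  apply ContinuousOn.mul
  · exact (continuousOn_const.sub continuousOn_id).rpow_const
      (fun x hx => Or.inl (by simp; linarith [hx.2]))
  · exact (continuousOn_const.add continuousOn_id).rpow_const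
      (fun x hx => Or.inl (by simp; linarith [hx.1]))

lemma jw_lower {α β l r : ℝ} (hl : -1 < l) (hlr : l < r) (hr : r < 1) :
    ∃ w : ℝ, 0 < w ∧ ∀ x ∈ Icc l r, w ≤ jacobiWeight α β x := by
  obtain ⟨y, hy, hm⟩ := isCompact_Icc.exists_isMinOn (nonempty_Icc.2 hlr.le)
    (jw_continuousOn (α := α) (β := β) hl hr)
  exact ⟨_, jw_pos ⟨hl.trans_le hy.1, hy.2.trans_lt hr⟩, fun x hx => hm hx⟩

lemma jw_upper {α β l r : ℝ} (hl : -1 < l) (hr : r < 1) :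
    ∃ w : ℝ, 0 < w ∧ ∀ x ∈ Icc l r, jacobiWeight α β x ≤ w := by
  obtain ⟨w, hw⟩ := isCompact_Icc.exists_bound_of_continuousOn
    (jw_continuousOn (α := α) (β := β) (l := l) (r := r) hl hr)
  refine ⟨|w| + 1, by positivity, fun x hx => ?_⟩
  have := hw x hx
  rw [Real.norm_eq_abs] at this
  linarith [le_abs_self (jacobiWeight α β x), le_abs_self w]

lemma jp_sq_interior {α β l r : ℝ} (hα : -1 < α) (hβ : -1 < β) (hl : -1 < l) (hlr : l < r)
    (hr : r < 1) : ∃ C : ℝ, 0 < C ∧ ∀ n : ℕ, 1 ≤ n → ∀ x ∈ Icc l r,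
      (jp n α β).eval x ^ 2 ≤ C * jh n α β := by
  obtain ⟨w, hw0, hw⟩ := jw_lower (α := α) (β := β) hl hlr hr
  set μ := (1 - r) * (1 + l) with hμ
  have hμ0 : 0 < μ := mul_pos (by linarith) (by linarith)
  set A := 2 * (|α - β| + |α + β + 1|) / μ with hA
  have hA0 : 0 ≤ A := by positivity
  set E := Real.exp (A * (r - l)) with hE
  have hE0 : 0 < E := Real.exp_pos _
  have hrl : 0 < r - l := by linarith
  refine ⟨2 * E / (w * (r - l)), by positivity, ?_⟩
  intro n hn x hx
  have hn1 : (1 : ℝ) ≤ n := by exact_mod_cast hn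
  set lam := (n : ℝ) * (n + α + β + 1) with hlam
  have hlam0 : 0 < lam := mul_pos (by linarith) (by linarith)
  set P := jp n α β with hP
  set F : Polynomial ℝ := Polynomial.C lam * P ^ 2 +
    (1 - Polynomial.X ^ 2) * Polynomial.derivative P ^ 2 with hF
  have hFe : ∀ y, F.eval y = lam * P.eval y ^ 2 +
      (1 - y ^ 2) * (Polynomial.derivative P).eval y ^ 2 := by intro y; simp [hF]
  have hFd : ∀ y, (Polynomial.derivative F).eval y =
      2 * (Polynomial.derivative P).eval y ^ 2 * (α - β + (α + β + 1) * y) := by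
    intro y
    have h := jp_ode n α β y
    rw [← hP] at h
    simp only [hF, Polynomial.derivative_add, Polynomial.derivative_mul, Polynomial.derivative_C,
      Polynomial.derivative_pow, Polynomial.derivative_sub, Polynomial.derivative_one,
      Polynomial.derivative_X, Polynomial.eval_add, Polynomial.eval_mul, Polynomial.eval_pow,
      Polynomial.eval_sub, Polynomial.eval_C, Polynomial.eval_X, Polynomial.eval_one,
      Polynomial.eval_zero]
    push_cast
    simp only [Nat.cast_ofNat, Nat.add_one_sub_one, pow_one]
    linear_combination 2 * (Polynomial.derivative P).eval y * h
  have hy1 : ∀ y ∈ Icc l r, μ ≤ 1 - y ^ 2 := by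
    intro y hy
    have h1 : (1 - r) * (1 + l) ≤ (1 - y) * (1 + y) :=
      mul_le_mul (by linarith [hy.2]) (by linarith [hy.1]) (by linarith) (by linarith [hy.2])
    nlinarith
  have hF0 : ∀ y ∈ Icc (-1 : ℝ) 1, 0 ≤ F.eval y := by
    intro y hy
    rw [hFe]
    have : 0 ≤ 1 - y ^ 2 := by nlinarith [hy.1, hy.2]
    positivity
  have hsub : Icc l r ⊆ Icc (-1 : ℝ) 1 := Icc_subset_Icc hl.le hr.le
  have hb : ∀ y ∈ Icc l r, |(Polynomial.derivative F).eval y| ≤ A * F.eval y := by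
    intro y hy
    rw [hFd, hFe, abs_mul, abs_of_nonneg (by positivity)]
    have h1 : |α - β + (α + β + 1) * y| ≤ |α - β| + |α + β + 1| := by
      refine (abs_add_le _ _).trans ?_
      rw [abs_mul]
      have : |y| ≤ 1 := abs_le.2 ⟨by linarith [hy.1], by linarith [hy.2]⟩
      have := mul_le_of_le_one_right (abs_nonneg (α + β + 1)) this
      linarith
    have h2 := hy1 y hy
    set d := (Polynomial.derivative P).eval y ^ 2 with hd
    have hd0 : 0 ≤ d := by positivity
    calc 2 * d * |α - β + (α + β + 1) * y| ≤ 2 * d * (|α - β| + |α + β + 1|) := by gcongr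
      _ = A * (μ * d) := by rw [hA]; field_simp
      _ ≤ _ := by
        apply mul_le_mul_of_nonneg_left _ hA0
        have : μ * d ≤ (1 - y ^ 2) * d := mul_le_mul_of_nonneg_right h2 hd0
        have : 0 ≤ lam * Polynomial.eval y P ^ 2 := by positivity
        linarith
  have hg : ∀ z ∈ Icc l r, F.eval x ≤ E * F.eval z := fun z hz =>
    jd_gronwall hA0 (fun y => F.hasDerivAt y) hb (fun y hy => hF0 y (hsub hy)) hx hz
  have hint : jI α β F = 2 * lam * jh n α β := by
    rw [hF, jI_add hα hβ, jI_C_mul, ← jI_succ, jI_deriv_sq n hα hβ]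
    simp only [jh, hlam, hP]
    ring
  have hii := jI_ii hα hβ F
  have h1 : ∫ z in l..r, F.eval z * jacobiWeight α β z ≤ jI α β F := by
    unfold jI
    apply intervalIntegral.integral_mono_interval hl.le hlr.le hr.le _ hii
    filter_upwards [ae_restrict_mem measurableSet_Ioc] with z hz
    exact mul_nonneg (hF0 z (Ioc_subset_Icc_self hz)) (jw_nonneg (Ioc_subset_Icc_self hz))
  have h2 : ∫ z in l..r, (F.eval x / E * w) ≤ ∫ z in l..r, F.eval z * jacobiWeight α β z := by
    apply intervalIntegral.integral_mono_on hlr.le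
    · exact intervalIntegrable_const
    · apply hii.mono_set
      rw [uIcc_of_le hlr.le, uIcc_of_le (by norm_num)]
      exact hsub
    · intro z hz
      have : F.eval x / E ≤ F.eval z := by
        rw [div_le_iff₀ hE0, mul_comm]; exact hg z hz
      exact mul_le_mul this (hw z hz) hw0.le (hF0 z (hsub hz))
  rw [intervalIntegral.integral_const, smul_eq_mul] at h2
  have h3 : (r - l) * (F.eval x / E * w) ≤ 2 * lam * jh n α β := by linarith
  have h4 : lam * P.eval x ^ 2 ≤ F.eval x := by
    rw [hFe]
    have := (hμ0.le).trans (hy1 x hx)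
    have : 0 ≤ (1 - x ^ 2) * (Polynomial.derivative P).eval x ^ 2 := by positivity
    linarith
  have h5 : (r - l) * (lam * P.eval x ^ 2 / E * w) ≤ 2 * lam * jh n α β := by
    refine le_trans ?_ h3
    gcongr
  have h6 : P.eval x ^ 2 * (w * (r - l)) ≤ 2 * E * jh n α β := by
    have e : (r - l) * (lam * P.eval x ^ 2 / E * w) =
      lam / E * (P.eval x ^ 2 * (w * (r - l))) := by ring
    have e2 : 2 * lam * jh n α β = lam / E * (2 * E * jh n α β) := by field_simp
    rw [e, e2] at h5
    exact le_of_mul_le_mul_left h5 (by positivity)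
  rw [div_mul_eq_mul_div, le_div_iff₀ (by positivity)]
  exact h6

lemma jJ_interior {α β l r : ℝ} (hα : -1 < α) (hβ : -1 < β) (hl : -1 < l) (hlr : l < r)
    (hr : r < 1) : ∃ C : ℝ, 0 < C ∧ ∀ n : ℕ, ∀ x ∈ Icc l r,
      |jJ n α β x| ≤ C / Real.sqrt ((n : ℝ) + 1) := by
  obtain ⟨w, hw0, hw⟩ := jw_upper (α := α) (β := β) hl hr
  obtain ⟨C1, hC1, h1⟩ := jp_sq_interior hα hβ hl hlr hr
  obtain ⟨C2, hC2, h2⟩ := jh_bound hα hβ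
  refine ⟨w * (Real.sqrt (C1 * C2) + 1), by positivity, ?_⟩
  intro n x hx
  have hx' : x ∈ Icc (-1 : ℝ) 1 := ⟨by linarith [hx.1], by linarith [hx.2]⟩
  have hwn := jw_nonneg (α := α) (β := β) hx'
  have key : |(jp n α β).eval x| ≤ (Real.sqrt (C1 * C2) + 1) / Real.sqrt ((n : ℝ) + 1) := by
    rcases Nat.eq_zero_or_pos n with rfl | hn
    · simp [jp]
    · have h3 := h1 n hn x hx
      have h4 : (jp n α β).eval x ^ 2 ≤ C1 * C2 / ((n : ℝ) + 1) := by
        rw [mul_div_assoc]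
        exact h3.trans (mul_le_mul_of_nonneg_left (h2 n) hC1.le)
      have h5 := Real.abs_le_sqrt h4
      rw [Real.sqrt_div (by positivity)] at h5
      refine h5.trans ?_
      gcongr
      linarith
  rw [jJ, abs_mul, abs_of_nonneg hwn, mul_comm, mul_div_assoc]
  exact mul_le_mul (hw x hx) key (abs_nonneg _) hw0.le

lemma jJ_global {α β : ℝ} (hα : -1 < α) (hβ : -1 < β) : ∃ C : ℝ, 0 < C ∧ ∀ n : ℕ,
    ∀ x ∈ Icc (-1 : ℝ) 1, |jJ n (α + 1) (β + 1) x| ≤ C * Real.sqrt ((n : ℝ) + 1) := by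
  obtain ⟨C2, hC2, h2⟩ := jh_bound hα hβ
  have hB := jI_sq_nonneg α β 1
  refine ⟨C2 + jI α β (1 ^ 2), by linarith, ?_⟩
  intro n x hx
  set N : ℝ := (n : ℝ) + 1 with hN
  have hN0 : 0 < N := by positivity
  set S := Real.sqrt N with hS
  have hS0 : 0 < S := Real.sqrt_pos.2 hN0
  have hSS : S * S = N := Real.mul_self_sqrt hN0.le
  set P := jp (n + 1) α β with hP
  have hii : IntervalIntegrable (fun y => -2 * N * jJ (n + 1) α β y) volume (-1) 1 :=
    (jI_ii hα hβ P).const_mul _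
  have hii' : IntervalIntegrable (fun y => -2 * N * jJ (n + 1) α β y) volume (-1) x :=
    hii.mono_set (by
      rw [uIcc_of_le hx.1, uIcc_of_le (by norm_num)]; exact Icc_subset_Icc le_rfl hx.2)
  have ftc := intervalIntegral.integral_eq_sub_of_hasDerivAt_of_le hx.1
    (f := jJ n (α + 1) (β + 1)) (jJ_continuous n (by linarith) (by linarith)).continuousOn
    (fun y hy => jJ_hasDerivAt n ⟨hy.1, hy.2.trans_le hx.2⟩) hii'
  have h0 : jJ n (α + 1) (β + 1) (-1) = 0 := by
    have h2 : β + 1 ≠ 0 := by linarith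
    simp [jJ, jacobiWeight, Real.zero_rpow h2]
  rw [h0, sub_zero] at ftc
  rw [← ftc]
  set Q : Polynomial ℝ := Polynomial.C (N * S) * P ^ 2 + Polynomial.C S * 1 ^ 2 with hQ
  have hQi : jI α β Q = N * S * jh (n + 1) α β + S * jI α β (1 ^ 2) := by
    rw [hQ, jI_add hα hβ, jI_C_mul, jI_C_mul]; rfl
  have hpt : ∀ y ∈ Icc (-1 : ℝ) 1, |-2 * N * jJ (n + 1) α β y| ≤ Q.eval y * jacobiWeight α β y := by
    intro y hy
    have hw := jw_nonneg (α := α) (β := β) hy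
    rw [jJ, ← mul_assoc, abs_mul, abs_of_nonneg hw]
    apply mul_le_mul_of_nonneg_right _ hw
    rw [abs_mul, abs_mul, abs_of_pos hN0]
    simp only [hQ, Polynomial.eval_add, Polynomial.eval_mul, Polynomial.eval_C,
      Polynomial.eval_pow, Polynomial.eval_one, one_pow, mul_one, ← hP]
    rw [← sq_abs (P.eval y)]
    set a := |P.eval y|
    have : (0 : ℝ) ≤ S * (S * a - 1) ^ 2 := by positivity
    rw [← hSS]
    norm_num
    nlinarith
  calc |∫ y in (-1 : ℝ)..x, -2 * N * jJ (n + 1) α β y|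
      ≤ ∫ y in (-1 : ℝ)..x, |-2 * N * jJ (n + 1) α β y| :=
        intervalIntegral.abs_integral_le_integral_abs hx.1
    _ ≤ ∫ y in (-1 : ℝ)..1, |-2 * N * jJ (n + 1) α β y| := by
        apply intervalIntegral.integral_mono_interval le_rfl hx.1 hx.2 _ hii.abs
        exact Filter.Eventually.of_forall (fun y => abs_nonneg _)
    _ ≤ jI α β Q := by
        apply intervalIntegral.integral_mono_on (by norm_num) hii.abs (jI_ii hα hβ Q) hpt
    _ ≤ _ := by
        rw [hQi]
        have := h2 (n + 1)
        rw [le_div_iff₀ (by positivity)] at this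
        push_cast at this
        rw [← hN] at this
        have h3 := jh_nonneg (n + 1) α β
        have h4 : N * jh (n + 1) α β ≤ C2 := by nlinarith
        nlinarith

/-! ### Oscillatory integral estimates -/

lemma jJ_left {n : ℕ} {α β : ℝ} (hβ : -1 < β) : jJ n (α + 1) (β + 1) (-1) = 0 := by
  have h2 : β + 1 ≠ 0 := by linarith
  simp [jJ, jacobiWeight, Real.zero_rpow h2]

lemma jJ_ii (n : ℕ) {α β l r : ℝ} (hα : -1 < α) (hβ : -1 < β) (hl : -1 ≤ l) (hlr : l ≤ r)
    (hr : r ≤ 1) : IntervalIntegrable (jJ n α β) volume l r := by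
  have := jI_ii hα hβ (jp n α β)
  refine this.mono_set ?_
  rw [uIcc_of_le hlr, uIcc_of_le (by norm_num)]
  exact Icc_subset_Icc hl hr

/-- The basic integration by parts step. -/
lemma jd_core (n : ℕ) {α β a δ l r : ℝ} (hα : -1 < α) (hβ : -1 < β) (ha : a < 1)
    (hl : -1 ≤ l) (hlr : l ≤ r) (hr : r ≤ a) {χ : ℝ → ℝ} (hχ : IsWAC l r χ)
    (hc : ContinuousOn (fun x => (a - x) ^ δ) (Icc l r))
    (hi : IntervalIntegrable (fun x => (a - x) ^ (δ - 1)) volume l r) :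
    ∫ x in l..r, (a - x) ^ δ * χ x * jJ (n + 1) α β x =
      (χ l * ((a - l) ^ δ * jJ n (α + 1) (β + 1) l)
        - χ r * ((a - r) ^ δ * jJ n (α + 1) (β + 1) r)
        + (∫ x in l..r, deriv χ x * ((a - x) ^ δ * jJ n (α + 1) (β + 1) x))
        - δ * ∫ x in l..r, (a - x) ^ (δ - 1) * χ x * jJ n (α + 1) (β + 1) x)
      / (2 * ((n : ℝ) + 1)) := by
  have hJc : Continuous (jJ n (α + 1) (β + 1)) := jJ_continuous n (by linarith) (by linarith)
  have hχc := jd_wac_cont hlr hχ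
  have hu : uIcc l r = Icc l r := uIcc_of_le hlr
  have i1 : IntervalIntegrable
      (fun x => (a - x) ^ (δ - 1) * jJ n (α + 1) (β + 1) x) volume l r :=
    hi.mul_continuousOn hJc.continuousOn
  have i2 : IntervalIntegrable (fun x => (a - x) ^ δ * jJ (n + 1) α β x) volume l r :=
    (jJ_ii (n + 1) hα hβ hl hlr (hr.trans ha.le)).continuousOn_mul (by rw [hu]; exact hc)
  have hd : ∀ x ∈ Ioo l r, HasDerivAt (fun x => (a - x) ^ δ * jJ n (α + 1) (β + 1) x)
      (-δ * ((a - x) ^ (δ - 1) * jJ n (α + 1) (β + 1) x)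
        + (-2 * ((n : ℝ) + 1)) * ((a - x) ^ δ * jJ (n + 1) α β x)) x := by
    intro x hx
    have h1 : HasDerivAt (fun y : ℝ => (a - y) ^ δ) (-δ * (a - x) ^ (δ - 1)) x := by
      have := ((hasDerivAt_id x).const_sub a).rpow_const (p := δ)
        (Or.inl (by simp only [id]; linarith [hx.2]))
      exact this.congr_deriv (by simp)
    have h2 := jJ_hasDerivAt n (α := α) (β := β) (x := x)
      ⟨by linarith [hx.1], by linarith [hx.2]⟩
    exact (h1.mul h2).congr_deriv (by ring)
  have main := jd_wac_ibp hlr hχ (hc.mul hJc.continuousOn) hd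
    ((i1.const_mul _).add (i2.const_mul _))
  have i1' : IntervalIntegrable
      (fun x => (a - x) ^ (δ - 1) * χ x * jJ n (α + 1) (β + 1) x) volume l r := by
    refine (i1.continuousOn_mul (g := χ) (by rw [hu]; exact hχc)).congr ?_
    intro x _; ring
  have i2' : IntervalIntegrable
      (fun x => (a - x) ^ δ * χ x * jJ (n + 1) α β x) volume l r := by
    refine (i2.continuousOn_mul (g := χ) (by rw [hu]; exact hχc)).congr ?_
    intro x _; ring
  have e : ∫ x in l..r, χ x * (-δ * ((a - x) ^ (δ - 1) * jJ n (α + 1) (β + 1) x)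
        + (-2 * ((n : ℝ) + 1)) * ((a - x) ^ δ * jJ (n + 1) α β x)) =
      -δ * (∫ x in l..r, (a - x) ^ (δ - 1) * χ x * jJ n (α + 1) (β + 1) x) +
      (-2 * ((n : ℝ) + 1)) * ∫ x in l..r, (a - x) ^ δ * χ x * jJ (n + 1) α β x := by
    rw [← intervalIntegral.integral_const_mul, ← intervalIntegral.integral_const_mul,
      ← intervalIntegral.integral_add (i1'.const_mul _) (i2'.const_mul _)]
    congr 1; funext x; ring
  rw [e] at main
  have hn : (0 : ℝ) < 2 * ((n : ℝ) + 1) := by positivity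
  rw [eq_div_iff hn.ne']
  simp only [Pi.mul_apply] at main
  linarith

lemma jd_rpow_cont {a δ l r : ℝ} (hr : r < a) :
    ContinuousOn (fun x => (a - x) ^ δ) (Icc l r) :=
  (continuousOn_const.sub continuousOn_id).rpow_const
      (fun x hx => Or.inl (by simp; linarith [hx.2]))

lemma jd_rpow_bound {a δ l r : ℝ} (hr : r < a) :
    ∃ W : ℝ, 0 < W ∧ ∀ x ∈ Icc l r, |(a - x) ^ δ| ≤ W := by
  obtain ⟨w, hw⟩ := isCompact_Icc.exists_bound_of_continuousOn
    (jd_rpow_cont (a := a) (δ := δ) (l := l) (r := r) hr)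
  refine ⟨|w| + 1, by positivity, fun x hx => ?_⟩
  have := hw x hx
  rw [Real.norm_eq_abs] at this
  linarith [le_abs_self w]

lemma jd_integral_bound {l r K : ℝ} (hlr : l ≤ r) {f : ℝ → ℝ} (h : ∀ x ∈ Icc l r, |f x| ≤ K) :
    |∫ x in l..r, f x| ≤ K * (r - l) := by
  have := intervalIntegral.norm_integral_le_of_norm_le_const (f := f) (a := l) (b := r) (C := K)
    (fun x hx => by
      rw [uIoc_of_le hlr] at hx
      exact h x (Ioc_subset_Icc_self hx))
  rwa [Real.norm_eq_abs, abs_of_nonneg (sub_nonneg.2 hlr)] at this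

lemma jd_E1 {α β a c δ : ℝ} (hα : -1 < α) (hβ : -1 < β) (ha : a < 1) (hc : -1 < c) (hca : c < a) :
    ∃ C : ℝ, 0 < C ∧ ∀ χ : ℝ → ℝ, IsWAC (-1) c χ → ∀ k : ℕ,
      |∫ x in (-1 : ℝ)..c, (a - x) ^ δ * χ x * jJ (k + 1) (α + 1) (β + 1) x| ≤
        C * wacNorm (-1) c χ / Real.sqrt ((k : ℝ) + 1) := by
  obtain ⟨G, hG0, hG⟩ := jJ_global (α := α + 1) (β := β + 1) (by linarith) (by linarith)
  obtain ⟨W, hW0, hW⟩ := jd_rpow_bound (δ := δ) (l := -1) hca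
  obtain ⟨V, hV0, hV⟩ := jd_rpow_bound (δ := δ - 1) (l := -1) hca
  refine ⟨3 * W * G + |δ| * (V * G * 2), by positivity, ?_⟩
  intro χ hχ k
  have hN : (0 : ℝ) < (k : ℝ) + 1 := by positivity
  set S := Real.sqrt ((k : ℝ) + 1) with hS
  have hS0 : 0 < S := Real.sqrt_pos.2 hN
  have hSS : S * S = (k : ℝ) + 1 := Real.mul_self_sqrt hN.le
  set n := wacNorm (-1) c χ with hn
  have hn0 : 0 ≤ n := jd_wacNorm_nonneg hc.le χ
  have hsub : ∀ x ∈ Icc (-1 : ℝ) c, x ∈ Icc (-1 : ℝ) 1 := fun x hx => ⟨hx.1, by linarith [hx.2]⟩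
  have hχb : ∀ x ∈ Icc (-1 : ℝ) c, |χ x| ≤ n := fun x hx => jd_wac_bdd hc.le hχ hx
  have hv : ∀ x ∈ Icc (-1 : ℝ) c,
      |(a - x) ^ δ * jJ k (α + 1 + 1) (β + 1 + 1) x| ≤ W * (G * S) := by
    intro x hx
    rw [abs_mul]
    exact mul_le_mul (hW x hx) (hG k x (hsub x hx)) (abs_nonneg _) hW0.le
  have hbd : ∀ x ∈ Icc (-1 : ℝ) c,
      |χ x * ((a - x) ^ δ * jJ k (α + 1 + 1) (β + 1 + 1) x)| ≤ n * (W * (G * S)) := by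
    intro x hx
    rw [abs_mul]
    exact mul_le_mul (hχb x hx) (hv x hx) (abs_nonneg _) hn0
  have h1 := hbd (-1) ⟨le_rfl, hc.le⟩
  have h2 := hbd c ⟨hc.le, le_rfl⟩
  have h3 := jd_wac_deriv_bound hc.le hχ hv
  have h4 : |∫ x in (-1 : ℝ)..c, (a - x) ^ (δ - 1) * χ x * jJ k (α + 1 + 1) (β + 1 + 1) x| ≤
      V * n * (G * S) * (c - -1) := by
    apply jd_integral_bound hc.le
    intro x hx
    rw [abs_mul, abs_mul]
    exact mul_le_mul (mul_le_mul (hV x hx) (hχb x hx) (abs_nonneg _) hV0.le) (hG k x (hsub x hx))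
      (abs_nonneg _) (by positivity)
  have h5 : V * n * (G * S) * (c - -1) ≤ V * n * (G * S) * 2 :=
    mul_le_mul_of_nonneg_left (by linarith) (by positivity)
  rw [jd_core k (by linarith) (by linarith) ha le_rfl hc.le hca.le hχ (jd_rpow_cont hca)
    ((jd_rpow_cont hca).intervalIntegrable_of_Icc hc.le), abs_div, abs_of_pos (a := 2 * _) (by positivity),
    div_le_div_iff₀ (by positivity) hS0]
  have h6 := mul_le_mul_of_nonneg_left (h4.trans h5) (abs_nonneg δ)
  rw [← abs_mul] at h6
  set X1 := χ (-1) * ((a - -1) ^ δ * jJ k (α + 1 + 1) (β + 1 + 1) (-1))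
  set X2 := χ c * ((a - c) ^ δ * jJ k (α + 1 + 1) (β + 1 + 1) c)
  set X3 := ∫ x in (-1 : ℝ)..c, deriv χ x * ((a - x) ^ δ * jJ k (α + 1 + 1) (β + 1 + 1) x)
  set X4 := δ * ∫ x in (-1 : ℝ)..c, (a - x) ^ (δ - 1) * χ x * jJ k (α + 1 + 1) (β + 1 + 1) x
  have h7 : |X1 - X2 + X3 - X4| ≤ |X1| + |X2| + |X3| + |X4| := by
    have t1 := abs_sub (X1 - X2 + X3) X4
    have t2 := abs_add_le (X1 - X2) X3
    have t3 := abs_sub X1 X2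
    linarith
  have h8 : |X1 - X2 + X3 - X4| ≤ (3 * W * G + |δ| * (V * G * 2)) * n * S := by
    refine h7.trans ?_
    have : (3 * W * G + |δ| * (V * G * 2)) * n * S =
      n * (W * (G * S)) + n * (W * (G * S)) + W * (G * S) * n + |δ| * (V * n * (G * S) * 2) := by
      ring
    linarith
  calc |X1 - X2 + X3 - X4| * S ≤ (3 * W * G + |δ| * (V * G * 2)) * n * S * S :=
        mul_le_mul_of_nonneg_right h8 hS0.le
    _ = (3 * W * G + |δ| * (V * G * 2)) * n * ((k : ℝ) + 1) := by rw [mul_assoc, hSS]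
    _ ≤ (3 * W * G + |δ| * (V * G * 2)) * n * (2 * ((k : ℝ) + 1)) := by
        apply mul_le_mul_of_nonneg_left _ (by positivity)
        linarith

lemma jd_E2 {α β a c δ : ℝ} (hα : -1 < α) (hβ : -1 < β) (ha : a < 1) (hc : -1 < c) (hca : c < a) :
    ∃ C : ℝ, 0 < C ∧ ∀ χ : ℝ → ℝ, IsWACIter 1 (-1) c χ → ∀ k : ℕ,
      |∫ x in (-1 : ℝ)..c, (a - x) ^ δ * χ x * jJ (k + 2) α β x| ≤
        C * wacNormIter 1 (-1) c χ / (((k : ℝ) + 1) * Real.sqrt ((k : ℝ) + 1)) := by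
  obtain ⟨G, hG0, hG⟩ := jJ_interior (α := α + 1) (β := β + 1) (l := c) (r := a)
    (by linarith) (by linarith) hc hca ha
  obtain ⟨W, hW0, hW⟩ := jd_rpow_bound (δ := δ) (l := -1) hca
  obtain ⟨C1, hC1, h1⟩ := jd_E1 (δ := δ) hα hβ ha hc hca
  obtain ⟨C2, hC2, h2⟩ := jd_E1 (δ := δ - 1) hα hβ ha hc hca
  refine ⟨W * G + C1 + |δ| * C2, by positivity, ?_⟩
  intro χ hχ k
  have hχ0 := jd_iter_zero hχ
  have hχ1 := jd_iter_zero (jd_iter_deriv hχ)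
  have hN : (0 : ℝ) < (k : ℝ) + 1 := by positivity
  set S := Real.sqrt ((k : ℝ) + 1) with hS
  have hS0 : 0 < S := Real.sqrt_pos.2 hN
  set n := wacNormIter 1 (-1) c χ with hn
  have hn0 : 0 ≤ n := jd_normIter_nonneg 1 hc.le χ
  have hb0 : wacNorm (-1) c χ ≤ n := jd_normIter_zero 1 hc.le χ
  have hb1 : wacNorm (-1) c (deriv χ) ≤ n :=
    (jd_normIter_zero 0 hc.le _).trans (jd_normIter_deriv 0 hc.le χ)
  have h3 : |∫ x in (-1 : ℝ)..c, deriv χ x * ((a - x) ^ δ * jJ (k + 1) (α + 1) (β + 1) x)| ≤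
      C1 * n / S := by
    have e : ∫ x in (-1 : ℝ)..c, deriv χ x * ((a - x) ^ δ * jJ (k + 1) (α + 1) (β + 1) x) =
      ∫ x in (-1 : ℝ)..c, (a - x) ^ δ * deriv χ x * jJ (k + 1) (α + 1) (β + 1) x := by
      congr 1; funext x; ring
    rw [e]
    refine (h1 _ hχ1 k).trans ?_
    gcongr
  have h4 : |∫ x in (-1 : ℝ)..c, (a - x) ^ (δ - 1) * χ x * jJ (k + 1) (α + 1) (β + 1) x| ≤
      C2 * n / S := by
    refine (h2 _ hχ0 k).trans ?_
    gcongr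
  have h5 : |χ c * ((a - c) ^ δ * jJ (k + 1) (α + 1) (β + 1) c)| ≤ n * (W * (G / S)) := by
    have hcc : c ∈ Icc (-1 : ℝ) c := ⟨hc.le, le_rfl⟩
    rw [abs_mul, abs_mul]
    have t1 := (jd_wac_bdd hc.le hχ0 hcc).trans hb0
    have t2 := hG (k + 1) c ⟨le_rfl, hca.le⟩
    have t3 : G / Real.sqrt (((k + 1 : ℕ) : ℝ) + 1) ≤ G / S := by
      apply div_le_div_of_nonneg_left hG0.le hS0
      apply Real.sqrt_le_sqrt
      push_cast; linarith
    exact mul_le_mul t1 (mul_le_mul (hW c hcc) (t2.trans t3) (abs_nonneg _) hW0.le)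
      (by positivity) hn0
  have h6 := mul_le_mul_of_nonneg_left h4 (abs_nonneg δ)
  rw [← abs_mul] at h6
  rw [jd_core (k + 1) hα hβ ha le_rfl hc.le hca.le hχ0 (jd_rpow_cont hca)
    ((jd_rpow_cont hca).intervalIntegrable_of_Icc hc.le), jJ_left hβ, mul_zero, mul_zero, zero_sub,
    abs_div, abs_of_pos (a := 2 * _) (by positivity)]
  set X2 := χ c * ((a - c) ^ δ * jJ (k + 1) (α + 1) (β + 1) c)
  set X3 := ∫ x in (-1 : ℝ)..c, deriv χ x * ((a - x) ^ δ * jJ (k + 1) (α + 1) (β + 1) x)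
  set X4 := δ * ∫ x in (-1 : ℝ)..c, (a - x) ^ (δ - 1) * χ x * jJ (k + 1) (α + 1) (β + 1) x
  have h8 : |-X2 + X3 - X4| ≤ (W * G + C1 + |δ| * C2) * n / S := by
    have t1 := abs_sub (-X2 + X3) X4
    have t2 := abs_add_le (-X2) X3
    rw [abs_neg] at t2
    have : (W * G + C1 + |δ| * C2) * n / S =
      n * (W * (G / S)) + C1 * n / S + |δ| * (C2 * n / S) := by ring
    linarith
  have h9 : (W * G + C1 + |δ| * C2) * n / (((k : ℝ) + 1) * S) =
    (W * G + C1 + |δ| * C2) * n / S / ((k : ℝ) + 1) := by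
    rw [div_div, mul_comm S]
  rw [h9]
  apply div_le_div₀ (by positivity) h8 hN
  push_cast; linarith

/-! ### The endpoint estimate -/

lemma jd_rpow_ii {a δ l r : ℝ} (hδ : -1 < δ) :
    IntervalIntegrable (fun x => (a - x) ^ δ) volume l r := by
  have := (intervalIntegral.intervalIntegrable_rpow' hδ (a := a - l) (b := a - r)).comp_sub_left a
  simpa using this

lemma jd_rpow_int {a δ x : ℝ} (hδ : -1 < δ) :
    ∫ t in x..a, (a - t) ^ δ = (a - x) ^ (δ + 1) / (δ + 1) := by
  rw [intervalIntegral.integral_comp_sub_left (fun t => t ^ δ) a, integral_rpow (Or.inl hδ)]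
  rw [sub_self, Real.zero_rpow (by linarith), sub_zero]

lemma jd_wac_one (l r : ℝ) : IsWAC l r (fun _ => 1) := by
  refine ⟨?_, ?_⟩
  · simp
  · intro x _; simp

lemma jd_pow_aux {N y δ γ : ℝ} (hN : 1 ≤ N) (hγ0 : γ ≤ 0) (hγδ : γ ≤ δ) (hy : 1 / N ≤ y)
    (hy2 : y ≤ 2) : y ^ δ ≤ 2 ^ |δ| * N ^ (-γ) := by
  have hN0 : 0 < N := by linarith
  have hy0 : 0 < y := lt_of_lt_of_le (by positivity) hy
  have hNγ : 1 ≤ N ^ (-γ) := Real.one_le_rpow hN (by linarith)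
  have h2 : (1 : ℝ) ≤ 2 ^ |δ| := Real.one_le_rpow (by norm_num) (abs_nonneg _)
  rcases le_total 0 δ with h | h
  · calc y ^ δ ≤ 2 ^ δ := Real.rpow_le_rpow hy0.le hy2 h
      _ = 2 ^ |δ| := by rw [abs_of_nonneg h]
      _ ≤ _ := le_mul_of_one_le_right (by linarith) hNγ
  · calc y ^ δ ≤ (1 / N) ^ δ := Real.rpow_le_rpow_of_nonpos (by positivity) hy h
      _ = N ^ (-δ) := by rw [one_div, Real.inv_rpow hN0.le, Real.rpow_neg hN0.le]
      _ ≤ N ^ (-γ) := Real.rpow_le_rpow_of_exponent_le hN (by linarith)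
      _ ≤ _ := le_mul_of_one_le_left (by linarith) h2

lemma jd_near {f : ℝ → ℝ} {a δ x B : ℝ} (hx : x ≤ a) (hδ : -1 < δ)
    (hf : ∀ t ∈ Icc x a, |f t| ≤ B) :
    |∫ t in x..a, (a - t) ^ δ * f t| ≤ B * ((a - x) ^ (δ + 1) / (δ + 1)) := by
  rw [← jd_rpow_int hδ, ← intervalIntegral.integral_const_mul, ← Real.norm_eq_abs]
  apply intervalIntegral.norm_integral_le_of_norm_le hx _ ((jd_rpow_ii hδ).const_mul B)
  filter_upwards with t ht
  have h0 : 0 ≤ (a - t) ^ δ := Real.rpow_nonneg (by linarith [ht.2]) _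
  rw [Real.norm_eq_abs, abs_mul, abs_of_nonneg h0, mul_comm]
  exact mul_le_mul_of_nonneg_right (hf t ⟨ht.1.le, ht.2⟩) h0

lemma jd_far {k : ℕ} {α β a δ x b B Y : ℝ} (hα : -1 < α) (hβ : -1 < β) (ha : a < 1) (hx : -1 ≤ x)
    (hxb : x ≤ b) (hb : b < a)
    (hJ : ∀ t ∈ Icc x b, |jJ k (α + 1) (β + 1) t| ≤ B) (hY : ∀ t ∈ Icc x b, (a - t) ^ δ ≤ Y) :
    |∫ t in x..b, (a - t) ^ δ * jJ (k + 1) α β t| ≤ 2 * (Y * B) / ((k : ℝ) + 1) := by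
  have hB0 : 0 ≤ B := (abs_nonneg _).trans (hJ x ⟨le_rfl, hxb⟩)
  have hpos : ∀ t ∈ Icc x b, 0 ≤ (a - t) ^ δ := fun t ht =>
    Real.rpow_nonneg (by linarith [ht.2]) _
  have hY0 : 0 ≤ Y := (hpos x ⟨le_rfl, hxb⟩).trans (hY x ⟨le_rfl, hxb⟩)
  have i1 : IntervalIntegrable (fun t => (a - t) ^ (δ - 1)) volume x b :=
    (jd_rpow_cont hb).intervalIntegrable_of_Icc hxb
  have core := jd_core k hα hβ ha hx hxb hb.le (jd_wac_one x b) (jd_rpow_cont hb) i1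
  simp only [mul_one, one_mul, deriv_const, zero_mul, intervalIntegral.integral_zero,
    add_zero] at core
  rw [core, abs_div, abs_of_pos (a := 2 * _) (by positivity),
    div_le_div_iff₀ (by positivity) (by positivity)]
  have e1 : |(a - x) ^ δ * jJ k (α + 1) (β + 1) x| ≤ Y * B := by
    rw [abs_mul, abs_of_nonneg (hpos x ⟨le_rfl, hxb⟩)]
    exact mul_le_mul (hY x ⟨le_rfl, hxb⟩) (hJ x ⟨le_rfl, hxb⟩) (abs_nonneg _) hY0
  have e2 : |(a - b) ^ δ * jJ k (α + 1) (β + 1) b| ≤ Y * B := by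
    rw [abs_mul, abs_of_nonneg (hpos b ⟨hxb, le_rfl⟩)]
    exact mul_le_mul (hY b ⟨hxb, le_rfl⟩) (hJ b ⟨hxb, le_rfl⟩) (abs_nonneg _) hY0
  have ftc : ∫ t in x..b, δ * (a - t) ^ (δ - 1) = (a - x) ^ δ - (a - b) ^ δ := by
    rw [intervalIntegral.integral_eq_sub_of_hasDerivAt_of_le hxb
      (f := fun t => - (a - t) ^ δ) (jd_rpow_cont hb).neg ?_ (i1.const_mul _)]
    · ring
    · intro y hy
      have := (((hasDerivAt_id y).const_sub a).rpow_const (p := δ)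
        (Or.inl (by simp only [id]; linarith [hy.2]))).neg
      exact this.congr_deriv (by simp)
  have e3 : |δ * ∫ t in x..b, (a - t) ^ (δ - 1) * jJ k (α + 1) (β + 1) t| ≤ 2 * (Y * B) := by
    have s1 : |∫ t in x..b, (a - t) ^ (δ - 1) * jJ k (α + 1) (β + 1) t| ≤
        B * ∫ t in x..b, (a - t) ^ (δ - 1) := by
      rw [← intervalIntegral.integral_const_mul, ← Real.norm_eq_abs]
      apply intervalIntegral.norm_integral_le_of_norm_le hxb _ (i1.const_mul B)
      filter_upwards with t ht
      have h0 : 0 ≤ (a - t) ^ (δ - 1) := Real.rpow_nonneg (by linarith [ht.2]) _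
      rw [Real.norm_eq_abs, abs_mul, abs_of_nonneg h0, mul_comm]
      exact mul_le_mul_of_nonneg_right (hJ t ⟨ht.1.le, ht.2⟩) h0
    have s0 : 0 ≤ ∫ t in x..b, (a - t) ^ (δ - 1) :=
      intervalIntegral.integral_nonneg hxb
        (fun t ht => Real.rpow_nonneg (by linarith [ht.2]) _)
    rw [intervalIntegral.integral_const_mul] at ftc
    have s2 : |δ| * ∫ t in x..b, (a - t) ^ (δ - 1) ≤ 2 * Y := by
      rw [← abs_of_nonneg s0, ← abs_mul, ftc]
      have q1 := hpos x ⟨le_rfl, hxb⟩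
      have q2 := hpos b ⟨hxb, le_rfl⟩
      have q3 := hY x ⟨le_rfl, hxb⟩
      have q4 := hY b ⟨hxb, le_rfl⟩
      rw [abs_le]; constructor <;> linarith
    rw [abs_mul]
    calc _ ≤ |δ| * (B * ∫ t in x..b, (a - t) ^ (δ - 1)) :=
          mul_le_mul_of_nonneg_left s1 (abs_nonneg _)
      _ = B * (|δ| * ∫ t in x..b, (a - t) ^ (δ - 1)) := by ring
      _ ≤ B * (2 * Y) := mul_le_mul_of_nonneg_left s2 hB0
      _ = _ := by ring
  have t1 := abs_sub ((a - x) ^ δ * jJ k (α + 1) (β + 1) x - (a - b) ^ δ * jJ k (α + 1) (β + 1) b)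
    (δ * ∫ t in x..b, (a - t) ^ (δ - 1) * jJ k (α + 1) (β + 1) t)
  have t2 := abs_sub ((a - x) ^ δ * jJ k (α + 1) (β + 1) x) ((a - b) ^ δ * jJ k (α + 1) (β + 1) b)
  have hk : (0 : ℝ) ≤ (k : ℝ) + 1 := by positivity
  calc _ ≤ 4 * (Y * B) * ((k : ℝ) + 1) := mul_le_mul_of_nonneg_right (by linarith) hk
    _ = _ := by ring

lemma jd_prod_ii (n : ℕ) {α β a δ c : ℝ} (hα : -1 < α) (hβ : -1 < β) (ha : a < 1) (hc : -1 < c)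
    (hca : c < a) (hδ : -1 < δ) {x : ℝ} (hx : x ∈ Icc c a) :
    IntervalIntegrable (fun t => (a - t) ^ δ * jJ n α β t) volume x a := by
  refine (jd_rpow_ii hδ).mul_continuousOn ?_
  rw [uIcc_of_le hx.2]
  intro t ht
  have : ContinuousAt (jJ n α β) t := by
    have h1 : (0:ℝ) < 1 - t := by linarith [ht.2]
    have h2 : (0:ℝ) < 1 + t := by linarith [ht.1, hx.1]
    unfold jJ jacobiWeight
    refine (jp n α β).continuous.continuousAt.mul (ContinuousAt.mul ?_ ?_)
    · exact (continuousAt_const.sub continuousAt_id).rpow_const (Or.inl h1.ne')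
    · exact (continuousAt_const.add continuousAt_id).rpow_const (Or.inl h2.ne')
  exact this.continuousWithinAt

lemma jd_F {α β a c δ γ : ℝ} (hα : -1 < α) (hβ : -1 < β) (ha : a < 1) (hc : -1 < c) (hca : c < a)
    (hδ : -1 < δ) (hγ0 : γ ≤ 0) (hγδ : γ ≤ δ) :
    ∃ C : ℝ, 0 < C ∧ ∀ k : ℕ, ∀ x ∈ Icc c a,
      |∫ t in x..a, (a - t) ^ δ * jJ (k + 2) α β t| ≤ C * ((k : ℝ) + 1) ^ (-γ - 3 / 2) := by
  obtain ⟨A, hA0, hA⟩ := jJ_interior hα hβ hc hca ha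
  obtain ⟨B, hB0, hB⟩ := jJ_interior (α := α + 1) (β := β + 1) (by linarith) (by linarith) hc hca ha
  have hδ1 : 0 < δ + 1 := by linarith
  refine ⟨A / (δ + 1) + 2 * 2 ^ |δ| * B, by positivity, ?_⟩
  intro k
  set N : ℝ := (k : ℝ) + 1 with hN
  have hN1 : 1 ≤ N := by rw [hN]; linarith [Nat.cast_nonneg (α := ℝ) k]
  have hN0 : 0 < N := by linarith
  have hsq : ∀ j : ℕ, k ≤ j → ∀ D : ℝ, 0 < D →
      D / Real.sqrt ((j : ℝ) + 1) ≤ D * N ^ (-(1 / 2) : ℝ) := by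
    intro j hj D hD
    rw [Real.rpow_neg hN0.le, ← Real.sqrt_eq_rpow, div_eq_mul_inv]
    have : (k : ℝ) ≤ j := by exact_mod_cast hj
    have hS : 0 < Real.sqrt N := Real.sqrt_pos.2 hN0
    gcongr
    linarith
  have near : ∀ x ∈ Icc c a, a - 1 / N ≤ x →
      |∫ t in x..a, (a - t) ^ δ * jJ (k + 2) α β t| ≤ A / (δ + 1) * N ^ (-γ - 3 / 2) := by
    intro x hx hxN
    refine (jd_near (B := A * N ^ (-(1 / 2) : ℝ)) hx.2 hδ (fun t ht =>
      (hA (k + 2) t ⟨hx.1.trans ht.1, ht.2⟩).trans (hsq (k + 2) (by omega) A hA0))).trans ?_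
    have h1 : (a - x) ^ (δ + 1) ≤ N ^ (-γ - 1) := by
      calc (a - x) ^ (δ + 1) ≤ (1 / N) ^ (δ + 1) :=
            Real.rpow_le_rpow (by linarith [hx.2]) (by linarith) hδ1.le
        _ = N ^ (-(δ + 1)) := by rw [one_div, Real.inv_rpow hN0.le, Real.rpow_neg hN0.le]
        _ ≤ _ := Real.rpow_le_rpow_of_exponent_le hN1 (by linarith)
    calc A * N ^ (-(1 / 2) : ℝ) * ((a - x) ^ (δ + 1) / (δ + 1))
        ≤ A * N ^ (-(1 / 2) : ℝ) * (N ^ (-γ - 1) / (δ + 1)) := by gcongr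
      _ = A / (δ + 1) * (N ^ (-(1 / 2) : ℝ) * N ^ (-γ - 1)) := by ring
      _ = _ := by rw [← Real.rpow_add hN0]; congr 2; ring
  intro x hx
  have hP : 0 < N ^ (-γ - 3 / 2) := Real.rpow_pos_of_pos hN0 _
  rcases le_total (a - 1 / N) x with h | h
  · refine (near x hx h).trans ?_
    gcongr
    have : 0 < 2 * 2 ^ |δ| * B := by positivity
    linarith
  · set b := a - 1 / N with hb
    have hba : b < a := by have : 0 < 1 / N := by positivity
                           linarith
    have hbI : b ∈ Icc c a := ⟨hx.1.trans h, hba.le⟩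
    have hfar := jd_far (k := k + 1) (δ := δ) (x := x) (b := b) (B := B * N ^ (-(1 / 2) : ℝ))
      (Y := 2 ^ |δ| * N ^ (-γ)) hα hβ ha (by linarith [hx.1]) h hba
      (fun t ht => (hB (k + 1) t ⟨hx.1.trans ht.1, ht.2.trans hba.le⟩).trans
        (hsq (k + 1) (by omega) B hB0))
      (fun t ht => jd_pow_aux hN1 hγ0 hγδ (by linarith [ht.2]) (by linarith [ht.1, hx.1]))
    have hnear := near b hbI le_rfl
    have hfar2 : 2 * (2 ^ |δ| * N ^ (-γ) * (B * N ^ (-(1 / 2) : ℝ))) / (((k + 1 : ℕ) : ℝ) + 1) ≤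
        2 * 2 ^ |δ| * B * N ^ (-γ - 3 / 2) := by
      calc _ ≤ 2 * (2 ^ |δ| * N ^ (-γ) * (B * N ^ (-(1 / 2) : ℝ))) / N := by
            gcongr
            push_cast; linarith
        _ = 2 * 2 ^ |δ| * B * (N ^ (-γ) * N ^ (-(1 / 2) : ℝ) * N ^ (-1 : ℝ)) := by
            rw [Real.rpow_neg_one]; ring
        _ = _ := by
            rw [← Real.rpow_add hN0, ← Real.rpow_add hN0]; congr 2; ring
    have i1 : IntervalIntegrable (fun t => (a - t) ^ δ * jJ (k + 2) α β t) volume x a :=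
      jd_prod_ii (k + 2) hα hβ ha hc hca hδ hx
    have i2 : IntervalIntegrable (fun t => (a - t) ^ δ * jJ (k + 2) α β t) volume b a :=
      jd_prod_ii (k + 2) hα hβ ha hc hca hδ hbI
    rw [← intervalIntegral.integral_add_adjacent_intervals (i1.trans i2.symm) i2]
    refine (abs_add_le _ _).trans ?_
    rw [add_mul]
    have := hfar.trans hfar2
    linarith

/-! ### Induction on the order -/

lemma jd_base {α β a c δ γ : ℝ} (hα : -1 < α) (hβ : -1 < β) (ha : a < 1) (hc : -1 < c) (hca : c < a)
    (hδ : -1 < δ) (hγ0 : γ ≤ 0) (hγδ : γ ≤ δ) :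
    ∃ C : ℝ, 0 < C ∧ ∀ ψ : ℝ → ℝ, IsWACIter 0 c a ψ → IsWACIter 1 (-1) c ψ → ∀ k : ℕ,
      |∫ x in (-1 : ℝ)..a, (a - x) ^ δ * ψ x * jJ (k + 2) α β x| ≤
        C * (wacNormIter 0 c a ψ + wacNormIter 1 (-1) c ψ) * ((k : ℝ) + 1) ^ (-γ - 3 / 2) := by
  obtain ⟨A, hA0, hA⟩ := jd_E2 (δ := δ) hα hβ ha hc hca
  obtain ⟨F, hF0, hF⟩ := jd_F hα hβ ha hc hca hδ hγ0 hγδ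
  refine ⟨A + 2 * F, by positivity, ?_⟩
  intro ψ h0 h1 k
  set N : ℝ := (k : ℝ) + 1 with hN
  have hN1 : 1 ≤ N := by rw [hN]; linarith [Nat.cast_nonneg (α := ℝ) k]
  have hN0 : 0 < N := by linarith
  have hw := jd_iter_zero h0
  have hw1 := jd_iter_zero h1
  set f : ℝ → ℝ := fun t => (a - t) ^ δ * jJ (k + 2) α β t with hf
  have i2 : IntervalIntegrable f volume c a :=
    jd_prod_ii (k + 2) hα hβ ha hc hca hδ ⟨le_rfl, hca.le⟩
  have i1 : IntervalIntegrable f volume (-1) c :=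
    (jJ_ii (k + 2) hα hβ le_rfl hc.le (by linarith)).continuousOn_mul
      (by rw [uIcc_of_le hc.le]; exact jd_rpow_cont hca)
  have j1 : IntervalIntegrable (fun x => (a - x) ^ δ * ψ x * jJ (k + 2) α β x) volume (-1) c := by
    refine (i1.continuousOn_mul (g := ψ) (by rw [uIcc_of_le hc.le]; exact jd_wac_cont hc.le hw1)).congr ?_
    intro x _; simp only [hf]; ring
  have j2 : IntervalIntegrable (fun x => (a - x) ^ δ * ψ x * jJ (k + 2) α β x) volume c a := by
    refine (i2.continuousOn_mul (g := ψ) (by rw [uIcc_of_le hca.le]; exact jd_wac_cont hca.le hw)).congr ?_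
    intro x _; simp only [hf]; ring
  have hP : 0 < N ^ (-γ - 3 / 2) := Real.rpow_pos_of_pos hN0 _
  have n0 := jd_normIter_nonneg 0 hca.le ψ
  have n1 := jd_normIter_nonneg 1 hc.le ψ
  have b1 : |∫ x in (-1 : ℝ)..c, (a - x) ^ δ * ψ x * jJ (k + 2) α β x| ≤
      A * wacNormIter 1 (-1) c ψ * N ^ (-γ - 3 / 2) := by
    refine (hA ψ h1 k).trans ?_
    have : ((k : ℝ) + 1) * Real.sqrt ((k : ℝ) + 1) = N ^ (3 / 2 : ℝ) := by
      rw [Real.sqrt_eq_rpow, ← hN]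
      nth_rewrite 1 [← Real.rpow_one N]
      rw [← Real.rpow_add hN0]; norm_num
    rw [this, div_eq_mul_inv, ← Real.rpow_neg hN0.le]
    exact mul_le_mul_of_nonneg_left (Real.rpow_le_rpow_of_exponent_le hN1 (by linarith))
      (by positivity)
  have hv : ∀ x ∈ Icc c a, |∫ t in a..x, f t| ≤ F * N ^ (-γ - 3 / 2) := by
    intro x hx
    rw [intervalIntegral.integral_symm, abs_neg]
    exact hF k x hx
  have b2 : |∫ x in c..a, (a - x) ^ δ * ψ x * jJ (k + 2) α β x| ≤
      2 * F * wacNormIter 0 c a ψ * N ^ (-γ - 3 / 2) := by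
    have e : ∫ x in c..a, (a - x) ^ δ * ψ x * jJ (k + 2) α β x = ∫ x in c..a, ψ x * f x := by
      congr 1; funext x; simp only [hf]; ring
    have hib := jd_ibp hca.le (u := ψ) (v := fun x => ∫ t in a..x, f t) (jd_wac_ii hca.le hw) i2
      hw.2 (by
        intro x hx
        have hca' : IntervalIntegrable f volume a c := i2.symm
        have hcx : IntervalIntegrable f volume c x := i2.mono_set (by
          rw [uIcc_of_le hca.le, uIcc_of_le hx.1]; exact Icc_subset_Icc le_rfl hx.2)
        exact (intervalIntegral.integral_add_adjacent_intervals hca' hcx).symm)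
    simp only [intervalIntegral.integral_same, mul_zero, zero_sub] at hib
    rw [e, hib]
    have d1 := jd_wac_deriv_bound hca.le hw hv
    have d2 : |ψ c * ∫ t in a..c, f t| ≤ wacNorm c a ψ * (F * N ^ (-γ - 3 / 2)) := by
      rw [abs_mul]
      exact mul_le_mul (jd_wac_bdd hca.le hw ⟨le_rfl, hca.le⟩) (hv c ⟨le_rfl, hca.le⟩)
        (abs_nonneg _) (jd_wacNorm_nonneg hca.le ψ)
    have d3 := abs_sub (-(ψ c * ∫ t in a..c, f t)) (∫ x in c..a, deriv ψ x * ∫ t in a..x, f t)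
    rw [abs_neg] at d3
    have d4 : 2 * F * wacNorm c a ψ * N ^ (-γ - 3 / 2) ≤
        2 * F * wacNormIter 0 c a ψ * N ^ (-γ - 3 / 2) := by
      gcongr
      exact jd_normIter_zero 0 hca.le ψ
    linarith
  rw [← intervalIntegral.integral_add_adjacent_intervals j1 j2]
  refine (abs_add_le _ _).trans ?_
  have e1 : 0 ≤ A * wacNormIter 0 c a ψ * N ^ (-γ - 3 / 2) := by positivity
  have e2 : 0 ≤ 2 * F * wacNormIter 1 (-1) c ψ * N ^ (-γ - 3 / 2) := by positivity
  linarith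

lemma jd_ind (M : ℕ) {a c : ℝ} (ha : a < 1) (hc : -1 < c) (hca : c < a) :
    ∀ α β δ γ : ℝ, -1 < α → -1 < β → -1 < γ → (M : ℝ) - 1 < γ → γ ≤ M → γ ≤ δ →
    ∃ C : ℝ, 0 < C ∧ ∀ ψ : ℝ → ℝ, IsWACIter M c a ψ → IsWACIter (M + 1) (-1) c ψ → ∀ k : ℕ,
      |∫ x in (-1 : ℝ)..a, (a - x) ^ δ * ψ x * jJ (k + M + 2) α β x| ≤
        C * (wacNormIter M c a ψ + wacNormIter (M + 1) (-1) c ψ) *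
          ((k : ℝ) + 1) ^ (-γ - 3 / 2) := by
  induction M with
  | zero =>
    intro α β δ γ hα hβ hγ _ hγ0 hγδ
    exact jd_base hα hβ ha hc hca (by linarith) (by simpa using hγ0) hγδ
  | succ M ih =>
    intro α β δ γ hα hβ hγ hγ1 hγ2 hγδ
    push_cast at hγ1 hγ2
    have hM0 : (0 : ℝ) ≤ M := Nat.cast_nonneg M
    have hδ0 : 0 < δ := by linarith
    obtain ⟨A, hA0, hA⟩ := ih (α + 1) (β + 1) δ (γ - 1) (by linarith) (by linarith) (by linarith)
      (by linarith) (by linarith) (by linarith)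
    obtain ⟨B, hB0, hB⟩ := ih (α + 1) (β + 1) (δ - 1) (γ - 1) (by linarith) (by linarith)
      (by linarith) (by linarith) (by linarith) (by linarith)
    refine ⟨A + δ * B, by positivity, ?_⟩
    intro ψ h0 h1 k
    set N : ℝ := (k : ℝ) + 1 with hN
    have hN1 : 1 ≤ N := by rw [hN]; linarith [Nat.cast_nonneg (α := ℝ) k]
    have hN0 : 0 < N := by linarith
    have hw := jd_wac_concat hc.le hca.le (jd_iter_zero h1) (jd_iter_zero h0)
    have core := jd_core (k + M + 2) (δ := δ) hα hβ ha le_rfl (hc.trans hca).le le_rfl hw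
      ((continuousOn_const.sub continuousOn_id).rpow_const (fun x _ => Or.inr hδ0.le))
      (jd_rpow_ii (by linarith))
    rw [jJ_left hβ, sub_self, Real.zero_rpow hδ0.ne'] at core
    simp only [mul_zero, zero_mul, sub_zero, zero_add] at core
    have a1 := hA (deriv ψ) (jd_iter_deriv h0) (jd_iter_deriv h1) k
    have a2 := hB ψ (jd_iter_mono (Nat.le_succ M) h0) (jd_iter_mono (Nat.le_succ (M + 1)) h1) k
    have e1 : ∫ x in (-1 : ℝ)..a, deriv ψ x * ((a - x) ^ δ * jJ (k + M + 2) (α + 1) (β + 1) x) =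
        ∫ x in (-1 : ℝ)..a, (a - x) ^ δ * deriv ψ x * jJ (k + M + 2) (α + 1) (β + 1) x := by
      congr 1; funext x; ring
    rw [e1] at core
    have hidx : k + (M + 1) + 2 = k + M + 2 + 1 := by ring
    rw [hidx, core, abs_div, abs_of_pos (a := 2 * _) (by positivity)]
    set S := wacNormIter (M + 1) c a ψ + wacNormIter (M + 1 + 1) (-1) c ψ with hS
    have hS0 : 0 ≤ S := add_nonneg (jd_normIter_nonneg _ hca.le ψ) (jd_normIter_nonneg _ hc.le ψ)
    have s1 : wacNormIter M c a (deriv ψ) + wacNormIter (M + 1) (-1) c (deriv ψ) ≤ S :=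
      add_le_add (jd_normIter_deriv M hca.le ψ) (jd_normIter_deriv (M + 1) hc.le ψ)
    have s2 : wacNormIter M c a ψ + wacNormIter (M + 1) (-1) c ψ ≤ S :=
      add_le_add (jd_normIter_succ M hca.le ψ) (jd_normIter_succ (M + 1) hc.le ψ)
    set P := N ^ (-(γ - 1) - 3 / 2) with hP
    have hP0 : 0 < P := Real.rpow_pos_of_pos hN0 _
    have a1' : _ ≤ A * S * P := a1.trans (by gcongr)
    have a2' : _ ≤ B * S * P := a2.trans (by gcongr)
    have hnum : |(∫ x in (-1 : ℝ)..a, (a - x) ^ δ * deriv ψ x * jJ (k + M + 2) (α + 1) (β + 1) x)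
        - δ * ∫ x in (-1 : ℝ)..a, (a - x) ^ (δ - 1) * ψ x * jJ (k + M + 2) (α + 1) (β + 1) x| ≤
        (A + δ * B) * S * P := by
      refine (abs_sub _ _).trans ?_
      rw [abs_mul, abs_of_pos hδ0]
      have := mul_le_mul_of_nonneg_left a2' hδ0.le
      linarith
    have hPN : P / N = N ^ (-γ - 3 / 2) := by
      rw [hP, div_eq_mul_inv, ← Real.rpow_neg_one, ← Real.rpow_add hN0]; congr 1; ring
    calc _ ≤ (A + δ * B) * S * P / N := by
          apply div_le_div₀ (by positivity) hnum hN0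
          push_cast; linarith [Nat.cast_nonneg (α := ℝ) k]
      _ = (A + δ * B) * S * (P / N) := by ring
      _ = _ := by rw [hPN]

theorem jacobi_coefficient_decay_left (α β γ a : ℝ) (hα : -1 < α) (hβ : -1 < β)
    (hγ : -1 < γ) (ha : a ∈ Set.Ioo (-1 : ℝ) 1) (m : ℤ) (hm : m = ⌈γ⌉ - 1) :
    ∃ C : ℝ, 0 < C ∧ ∃ N : ℕ, ∀ ψ : ℝ → ℝ,
      IsWACIter (m + 1).toNat ((-1 + a) / 2) a ψ →
      IsWACIter (m + 2).toNat (-1) ((-1 + a) / 2) ψ →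
      ∀ n : ℕ, N ≤ n →
        |∫ x in (-1 : ℝ)..a, (a - x) ^ γ * ψ x * jacobiP α β n x * jacobiWeight α β x| ≤
          C * (wacNormIter (m + 1).toNat ((-1 + a) / 2) a ψ +
               wacNormIter (m + 2).toNat (-1) ((-1 + a) / 2) ψ) * (n : ℝ) ^ (-γ - 3 / 2) := by
  obtain ⟨ha1, ha2⟩ := ha
  have hceil : (0 : ℤ) ≤ ⌈γ⌉ := by
    have : (-1 : ℤ) < ⌈γ⌉ := Int.lt_ceil.2 (by simpa using hγ)
    omega
  obtain ⟨M, hM⟩ := Int.eq_ofNat_of_zero_le hceil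
  have e1 : (m + 1).toNat = M := by omega
  have e2 : (m + 2).toNat = M + 1 := by omega
  rw [e1, e2]
  have hMr : ((⌈γ⌉ : ℤ) : ℝ) = M := by rw [hM]; simp
  have hg1 : (M : ℝ) - 1 < γ := by rw [← hMr]; linarith [Int.ceil_lt_add_one γ]
  have hg2 : γ ≤ M := by rw [← hMr]; exact Int.le_ceil γ
  have hc1 : -1 < (-1 + a) / 2 := by linarith
  have hc2 : (-1 + a) / 2 < a := by linarith
  obtain ⟨C, hC0, hC⟩ := jd_ind M ha2 hc1 hc2 α β γ γ hα hβ hγ hg1 hg2 le_rfl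
  have hQ : (0 : ℝ) < (M : ℝ) + 2 := by positivity
  refine ⟨C * ((M : ℝ) + 2) ^ (γ + 3 / 2), by positivity, M + 2, ?_⟩
  intro ψ h0 h1 n hn
  obtain ⟨k, rfl⟩ := Nat.exists_eq_add_of_le hn
  have hidx : M + 2 + k = k + M + 2 := by ring
  rw [hidx]
  have hint : ∫ x in (-1 : ℝ)..a, (a - x) ^ γ * ψ x * jacobiP α β (k + M + 2) x *
        jacobiWeight α β x =
      ∫ x in (-1 : ℝ)..a, (a - x) ^ γ * ψ x * jJ (k + M + 2) α β x := by
    apply jd_integral_congr_Ioo ha1.le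
    intro x hx
    rw [mul_assoc, jacobi_eq_jJ _ ⟨hx.1, hx.2.trans ha2⟩]
  rw [hint]
  refine (hC ψ h0 h1 k).trans ?_
  set S := wacNormIter M ((-1 + a) / 2) a ψ + wacNormIter (M + 1) (-1) ((-1 + a) / 2) ψ with hS
  have hS0 : 0 ≤ S := add_nonneg (jd_normIter_nonneg _ hc2.le ψ) (jd_normIter_nonneg _ hc1.le ψ)
  have hk : (0 : ℝ) ≤ k := Nat.cast_nonneg k
  have hnpos : (0 : ℝ) < ((k + M + 2 : ℕ) : ℝ) := by positivity
  have hle : ((k + M + 2 : ℕ) : ℝ) ≤ ((M : ℝ) + 2) * ((k : ℝ) + 1) := by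
    push_cast
    nlinarith [Nat.cast_nonneg (α := ℝ) M]
  have hpow : ((k : ℝ) + 1) ^ (-γ - 3 / 2) ≤
      ((M : ℝ) + 2) ^ (γ + 3 / 2) * ((k + M + 2 : ℕ) : ℝ) ^ (-γ - 3 / 2) := by
    have h := Real.rpow_le_rpow_of_nonpos hnpos hle (by linarith : -γ - 3 / 2 ≤ 0)
    rw [Real.mul_rpow hQ.le (by positivity)] at h
    have h2 := mul_le_mul_of_nonneg_left h (Real.rpow_nonneg hQ.le (γ + 3 / 2))
    rw [← mul_assoc, ← Real.rpow_add hQ] at h2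
    have : γ + 3 / 2 + (-γ - 3 / 2) = 0 := by ring
    rwa [this, Real.rpow_zero, one_mul] at h2
  calc _ ≤ C * S * (((M : ℝ) + 2) ^ (γ + 3 / 2) * ((k + M + 2 : ℕ) : ℝ) ^ (-γ - 3 / 2)) :=
        mul_le_mul_of_nonneg_left hpow (by positivity)
    _ = _ := by ring
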